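/- arXiv:1901.03980 — 2 statements merged into one kernel-verified Lean document; each statement's English description precedes it below -/
import Mathlib

section
/- Let n ≥ 2 and let G be a dicyclic group of order 4n (so that D(G) = 3n). A sequence S over G of length 3n is a minimal product-one sequence if and only if there exist α, τ ∈ G generating G with α^{2n} = 1_G, τ^2 = α^n and τα = α^{-1}τ such that S = α^{[3n-2]} · τ^{[2]}. -/
/-- A multiset over a group is a *product-one sequence* if its terms can be
ordered so that their product is `1`. -/
def IsProductOne {G : Type*} [Group G] (S : Multiset G) : Prop :=
  ∃ l : List G, (l : Multiset G) = S ∧ l.prod = 1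

/-- A product-one sequence is *minimal* if it is non-trivial and cannot be written
as a concatenation of two non-trivial product-one sequences. -/
def IsMinimalProductOne {G : Type*} [Group G] (S : Multiset G) : Prop :=
  S ≠ 0 ∧ IsProductOne S ∧
    ∀ T₁ T₂ : Multiset G, T₁ ≠ 0 → T₂ ≠ 0 → IsProductOne T₁ → IsProductOne T₂ →
      S ≠ T₁ + T₂

section Generic
variable {A : Type*} [AddCommGroup A]

/-- signed sums -/
def SV (E : Multiset A) : Set A := {v | ∃ P Q : Multiset A, P + Q = E ∧ v = P.sum - Q.sum}

theorem SV_zero : SV (0 : Multiset A) = {0} := by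
  ext v
  simp only [SV, Set.mem_ofPred_eq, Set.mem_singleton_iff]
  constructor
  · rintro ⟨P, Q, h, rfl⟩
    have := add_eq_zero.mp h
    simp [this.1, this.2]
  · rintro rfl
    exact ⟨0, 0, by simp, by simp⟩

theorem SV_add {E F : Multiset A} {v : A} :
    v ∈ SV (E + F) ↔ ∃ x ∈ SV E, ∃ y ∈ SV F, v = x + y := by
  classical
  constructor
  · rintro ⟨P, Q, h, rfl⟩
    obtain ⟨P1, hP1, P2, hP2, Q1, Q2, h1, h2, h3⟩ :
        ∃ P1, P1 ≤ P ∧ ∃ P2, P = P1 + P2 ∧ ∃ Q1 Q2, Q = Q1 + Q2 ∧ P1 + Q1 = E ∧ P2 + Q2 = F := by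
      refine ⟨P ∩ E, Multiset.inter_le_left, P - P ∩ E, ?_, E - P ∩ E, Q - (E - P ∩ E), ?_, ?_, ?_⟩
      all_goals
        ext a
        have := congrArg (Multiset.count a) h
        simp only [Multiset.count_add, Multiset.count_sub, Multiset.count_inter] at this ⊢
        omega
    refine ⟨P1.sum - Q1.sum, ⟨P1, Q1, h2, rfl⟩, P2.sum - Q2.sum, ⟨P2, Q2, h3, rfl⟩, ?_⟩
    rw [hP2, h1]
    simp only [Multiset.sum_add]
    abel
  · rintro ⟨x, ⟨P, Q, h, rfl⟩, y, ⟨P', Q', h', rfl⟩, rfl⟩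
    refine ⟨P + P', Q + Q', ?_, ?_⟩
    · rw [← h, ← h']; abel
    · simp only [Multiset.sum_add]; abel

theorem SV_sum_mem (E : Multiset A) : E.sum ∈ SV E := ⟨E, 0, by simp, by simp⟩

theorem SV_neg_sum_mem (E : Multiset A) : -E.sum ∈ SV E := ⟨0, E, by simp, by simp⟩

theorem SV_single {e v : A} : v ∈ SV {e} ↔ v = e ∨ v = -e := by
  constructor
  · rintro ⟨P, Q, h, rfl⟩
    rcases Multiset.card_eq_one.mp (show (P + Q).card = 1 by rw [h]; simp) with _
    have hc : P.card + Q.card = 1 := by rw [← Multiset.card_add, h]; simp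
    rcases Nat.eq_zero_or_pos P.card with h0 | h0
    · rw [Multiset.card_eq_zero] at h0
      subst h0
      right; simp at h; simp [h]
    · have : Q = 0 := by rw [← Multiset.card_eq_zero]; omega
      subst this
      left; simp at h; simp [h]
  · rintro (rfl | rfl)
    · simpa using SV_sum_mem {v}
    · simpa using SV_neg_sum_mem {e}

theorem SV_cons {e v : A} {E : Multiset A} :
    v ∈ SV (e ::ₘ E) ↔ v - e ∈ SV E ∨ v + e ∈ SV E := by
  rw [← Multiset.singleton_add, SV_add]
  constructor
  · rintro ⟨x, hx, y, hy, rfl⟩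
    rcases SV_single.mp hx with rfl | rfl
    · left; simpa using hy
    · right; simpa using hy
  · rintro (h | h)
    · exact ⟨e, SV_single.mpr (Or.inl rfl), _, h, by abel⟩
    · exact ⟨-e, SV_single.mpr (Or.inr rfl), _, h, by abel⟩

theorem SV_even {E : Multiset A} {v : A} (h : v ∈ SV E) : Even (v - E.sum) := by
  obtain ⟨P, Q, rfl, rfl⟩ := h
  exact ⟨-Q.sum, by simp only [Multiset.sum_add]; abel⟩

/-- stabilizer -/
def stb (X : Set A) : AddSubgroup A where
  carrier := {g | ∀ x, x + g ∈ X ↔ x ∈ X}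
  zero_mem' := by simp
  add_mem' := by
    intro a b ha hb x
    rw [← add_assoc, hb, ha]
  neg_mem' := by
    intro a ha x
    have := ha (x + -a)
    simp only [neg_add_cancel_right] at this
    exact this.symm

theorem mem_stb {X : Set A} {g : A} : g ∈ stb X ↔ ∀ x, x + g ∈ X ↔ x ∈ X := Iff.rfl

/-- fullness -/
def Full (E : Multiset A) : Prop := ∀ v, Even (v - E.sum) → v ∈ SV E

theorem stb_mono (E F : Multiset A) : stb (SV E) ≤ stb (SV (E + F)) := by
  intro g hg x
  constructor
  · intro h
    obtain ⟨u, hu, w, hw, h⟩ := SV_add.mp h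
    refine SV_add.mpr ⟨u - g, ?_, w, hw, ?_⟩
    · rw [← hg]; simpa using hu
    · rw [eq_sub_of_add_eq h]; abel
  · intro h
    obtain ⟨u, hu, w, hw, rfl⟩ := SV_add.mp h
    exact SV_add.mpr ⟨u + g, (hg u).mpr hu, w, hw, by abel⟩

theorem Full.add {E : Multiset A} (h : Full E) (F : Multiset A) : Full (E + F) := by
  intro v hv
  refine SV_add.mpr ⟨v - F.sum, h _ ?_, F.sum, SV_sum_mem F, by abel⟩
  rw [Multiset.sum_add] at hv
  convert hv using 1; abel

theorem full_of_stb {E : Multiset A} (h : ∀ y : A, y + y ∈ stb (SV E)) : Full E := by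
  rintro v ⟨y, hy⟩
  have := (h y E.sum).mpr (SV_sum_mem E)
  rwa [← hy, add_sub_cancel] at this

theorem stb_even {E : Multiset A} {g : A} (h : g ∈ stb (SV E)) : Even g := by
  have := SV_even ((h _).mpr (SV_sum_mem E))
  simpa using this

theorem SV_stuck1 {K : AddSubgroup A} {T : Multiset A} (hT : ∀ w ∈ T, w + w ∈ K) {t : A}
    (ht : t ∈ SV T) : t - T.sum ∈ K := by
  induction T using Multiset.induction_on generalizing t with
  | empty => simp [SV_zero] at ht; simp [ht]
  | cons e E ih =>
    have he := hT e (Multiset.mem_cons_self _ _)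
    have hE := fun w hw => hT w (Multiset.mem_cons_of_mem hw)
    rw [Multiset.sum_cons]
    rcases SV_cons.mp ht with h | h
    · convert ih hE h using 1; abel
    · convert K.sub_mem (ih hE h) he using 1; abel

/-- removing a zero-sum part lying in the stabilizer range -/
theorem SV_stuck {E T F : Multiset A} {v : A} (hT : ∀ w ∈ T, w + w ∈ stb (SV E))
    (hs : T.sum = 0) (h : v ∈ SV (E + T + F)) : v ∈ SV (E + F) := by
  obtain ⟨x, hx, y, hy, rfl⟩ := SV_add.mp h
  obtain ⟨u, hu, w, hw, rfl⟩ := SV_add.mp hx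
  have := SV_stuck1 hT hw
  rw [hs, sub_zero] at this
  exact SV_add.mpr ⟨u + w, (this u).mpr hu, y, hy, rfl⟩


theorem stb_subgroup (K L : AddSubgroup A) (h : K ≤ L) : K ≤ stb (L : Set A) := by
  intro g hg x
  exact L.add_mem_cancel_right (h hg)

section Fin
variable [Finite A]

theorem ncard_lt_add {X Y : Set A} {K : AddSubgroup A} (hX : K ≤ stb X) (hY : K ≤ stb Y)
    (hXY : X ⊂ Y) : X.ncard + Nat.card K ≤ Y.ncard := by
  obtain ⟨y, hy, hyX⟩ := Set.exists_of_ssubset hXY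
  have h1 : (Set.image (fun g : A => y + g) (K : Set A)).ncard = Nat.card K := by
    rw [Set.ncard_image_of_injective _ (add_right_injective y)]
    rfl
  have h2 : Disjoint X (Set.image (fun g : A => y + g) (K : Set A)) := by
    rw [Set.disjoint_left]
    rintro _ hx ⟨g, hg, rfl⟩
    exact hyX ((hX hg y).mp hx)
  rw [← h1, ← Set.ncard_union_eq h2]
  refine Set.ncard_le_ncard ?_ (Set.toFinite _)
  rintro z (hz | ⟨g, hg, rfl⟩)
  · exact hXY.1 hz
  · exact (hY hg y).mpr hy

theorem SV_grow {E : Multiset A} {e : A} (h : e + e ∉ stb (SV E)) :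
    (SV E).ncard + Nat.card (stb (SV E)) ≤ (SV (E + {e})).ncard := by
  let X : Set A := Set.image (fun x => x + e) (SV E)
  have hX : X.ncard = (SV E).ncard := Set.ncard_image_of_injective _ (add_left_injective e)
  rw [← hX]
  have hsub : X ⊆ SV (E + {e}) := by
    rintro _ ⟨x, hx, rfl⟩
    exact SV_add.mpr ⟨x, hx, e, SV_single.mpr (Or.inl rfl), rfl⟩
  refine ncard_lt_add ?_ (stb_mono _ _) ⟨hsub, ?_⟩
  · intro g hg x
    constructor
    · rintro ⟨y, hy, h⟩
      refine ⟨y - g, ?_, ?_⟩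
      · rw [← hg]; simpa using hy
      · simp only at h ⊢; rw [eq_sub_of_add_eq h.symm]; abel
    · rintro ⟨y, hy, rfl⟩
      exact ⟨y + g, (hg y).mpr hy, by simp only; abel⟩
  · intro hsup
    apply h
    -- `SV E - e ⊆ SV E + e`
    have h1 : ∀ x ∈ SV E, x - (e + e) ∈ SV E := by
      intro x hx
      have : x + -e ∈ SV (E + {e}) := SV_add.mpr ⟨x, hx, -e, SV_single.mpr (Or.inr rfl), rfl⟩
      obtain ⟨y, hy, hh⟩ := hsup this
      simp only at hh
      have : y = x - (e + e) := by rw [eq_sub_of_add_eq hh]; abel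
      rwa [← this]
    have h2 : Set.image (fun x => x - (e + e)) (SV E) = SV E := by
      refine Set.eq_of_subset_of_ncard_le ?_ ?_ (Set.toFinite _)
      · rintro _ ⟨x, hx, rfl⟩; exact h1 x hx
      · rw [Set.ncard_image_of_injective _ sub_left_injective]
    intro x
    constructor
    · intro hx; simpa using h1 _ hx
    · intro hx
      rw [← h2] at hx
      obtain ⟨y, hy, rfl⟩ := hx
      simpa using hy

theorem greedy {ι : Type*} (f : ι → A) (c : ℕ) : ∀ (E : Multiset A) (D : Multiset ι),
    c ≤ Nat.card (stb (SV E)) →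
    ∃ U W : Multiset ι, D = U + W ∧ (∀ w ∈ W, f w + f w ∈ stb (SV (E + U.map f))) ∧
      (SV E).ncard + U.card * c ≤ (SV (E + U.map f)).ncard := by
  intro E D
  induction hD : D.card generalizing E D with
  | zero =>
    intro _
    rw [Multiset.card_eq_zero] at hD
    subst hD
    exact ⟨0, 0, by simp, by simp, by simp⟩
  | succ k ih =>
    intro hc
    by_cases hall : ∀ w ∈ D, f w + f w ∈ stb (SV E)
    · exact ⟨0, D, by simp, by simpa using hall, by simp⟩
    · push Not at hall
      obtain ⟨w, hw, hwE⟩ := hall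
      obtain ⟨D', rfl⟩ := Multiset.exists_cons_of_mem hw
      have hle : Nat.card (stb (SV E)) ≤ Nat.card (stb (SV (E + {f w}))) :=
        AddSubgroup.card_le_of_le (stb_mono _ _)
      obtain ⟨U, W, h1, h2, h3⟩ := ih (E + {f w}) D' (by simpa using hD) (hc.trans hle)
      have hg := SV_grow hwE
      have he : E + (w ::ₘ U).map f = E + {f w} + U.map f := by
        rw [Multiset.map_cons, ← Multiset.singleton_add, add_assoc]
      refine ⟨w ::ₘ U, W, by rw [h1]; simp, ?_, ?_⟩
      · rw [he]; exact h2
      · rw [he, Multiset.card_cons, Nat.add_mul]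
        omega

end Fin

/-- zero-sum free -/
def ZSF (W : Multiset A) : Prop := ∀ T ≤ W, T ≠ 0 → T.sum ≠ 0

theorem ZSF.take_ne {l : List A} (h : ZSF (l : Multiset A)) {i j : ℕ} (hij : i < j)
    (hj : j ≤ l.length) : (l.take i).sum ≠ (l.take j).sum := by
  intro he
  have h1 : l.take j = l.take i ++ (l.take j).drop i := by
    conv_lhs => rw [← List.take_append_drop i (l.take j)]
    rw [List.take_take, min_eq_left hij.le]
  have h2 : ((l.take j).drop i).sum = 0 := by
    rw [h1, List.sum_append] at he
    simpa using he
  refine h ((l.take j).drop i : List A) ?_ ?_ (by simpa using h2)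
  · exact ((List.drop_sublist _ _).trans (List.take_sublist _ _)).subperm
  · intro h0
    have := congrArg Multiset.card h0
    simp at this
    omega

theorem ZSF.card_lt {W : Multiset A} (h : ZSF W) (H : AddSubgroup A) [Finite H]
    (hW : ∀ w ∈ W, w ∈ H) : W.card < Nat.card H := by
  induction W using Quotient.inductionOn with | _ l => ?_
  simp only [Multiset.quot_mk_to_coe, Multiset.coe_card, Multiset.mem_coe] at *
  have hinj : Function.Injective (fun i : Fin (l.length + 1) =>
      (⟨(l.take i).sum, AddSubgroup.list_sum_mem _ fun x hx => hW x (List.mem_of_mem_take hx)⟩ : H)) := by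
    intro i j hij
    simp only [Subtype.mk.injEq] at hij
    rcases lt_trichotomy i j with hlt | rfl | hlt
    · exact absurd hij (h.take_ne hlt (by omega))
    · rfl
    · exact absurd hij.symm (h.take_ne hlt (by omega))
  have := Nat.card_le_card_of_injective _ hinj
  simp at this
  omega

theorem ZSF.mono {W W' : Multiset A} (h : ZSF W) (hle : W' ≤ W) : ZSF W' :=
  fun T hT => h T (hT.trans hle)

/-- long zero-sum free sequences represent everything as a signed sum -/
theorem ZSF.signed [Finite A] {W : Multiset A} (h : ZSF W) (hc : Nat.card A < 2 * (W.card + 1)) (d : A) :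
    ∃ T W', W = T + W' ∧ (0 : A) ∈ SV (T + {d}) := by
  induction W using Quotient.inductionOn with | _ l => ?_
  simp only [Multiset.quot_mk_to_coe, Multiset.coe_card] at *
  have := Fintype.ofFinite A
  classical
  let s : Fin (l.length + 1) → A := fun i => (l.take i).sum
  have hinj : Function.Injective s := by
    intro i j hij
    rcases lt_trichotomy i j with hlt | rfl | hlt
    · exact absurd hij (h.take_ne hlt (by omega))
    · rfl
    · exact absurd hij.symm (h.take_ne hlt (by omega))
  have key : ∀ i j : ℕ, i ≤ j → ∃ T W' : Multiset A, (l : Multiset A) = T + W' ∧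
      (l.take j).sum = (l.take i).sum + T.sum := by
    intro i j hij
    have h1 : l.take j = l.take i ++ (l.take j).drop i := by
      conv_lhs => rw [← List.take_append_drop i (l.take j)]
      rw [List.take_take, min_eq_left hij]
    have hs : (((l.take j).drop i : List A) : Multiset A) ≤ (l : Multiset A) :=
      ((List.drop_sublist _ _).trans (List.take_sublist _ _)).subperm
    obtain ⟨W', hW'⟩ := Multiset.le_iff_exists_add.mp hs
    refine ⟨_, W', hW', ?_⟩
    conv_lhs => rw [h1, List.sum_append]
    simp
  let X : Finset A := Finset.univ.image s
  let Y : Finset A := Finset.univ.image (fun i => s i + d)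
  have hX : X.card = l.length + 1 := by
    rw [Finset.card_image_of_injective _ hinj]; simp
  have hY : Y.card = l.length + 1 := by
    have hi : Function.Injective (fun i => s i + d) := (add_left_injective d).comp hinj
    rw [Finset.card_image_of_injective _ hi]; simp
  have hne : ¬ Disjoint X Y := by
    intro hd
    have := Finset.card_union_of_disjoint hd
    have h2 := Finset.card_le_univ (X ∪ Y)
    rw [Nat.card_eq_fintype_card] at hc
    omega
  obtain ⟨z, hzX, hzY⟩ := Finset.not_disjoint_iff.mp hne
  simp only [X, Y, Finset.mem_image, Finset.mem_univ, true_and, s] at hzX hzY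
  obtain ⟨i, rfl⟩ := hzX
  obtain ⟨j, hj⟩ := hzY
  rcases le_total (i : ℕ) j with hij | hij
  · obtain ⟨T, W', h1, h2⟩ := key i j hij
    refine ⟨T, W', h1, SV_add.mpr ⟨T.sum, SV_sum_mem T, d, SV_single.mpr (Or.inl rfl), ?_⟩⟩
    rw [h2, add_assoc] at hj
    have h3 : T.sum + d = 0 := by simpa using hj
    exact h3.symm
  · obtain ⟨T, W', h1, h2⟩ := key j i hij
    refine ⟨T, W', h1, SV_add.mpr ⟨-T.sum, SV_neg_sum_mem T, d, SV_single.mpr (Or.inl rfl), ?_⟩⟩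
    rw [h2] at hj
    have := add_left_cancel hj
    rw [this]; simp

theorem ZSF.eq_replicate [Finite A] {W : Multiset A} (h : ZSF W) (hc : W.card + 1 = Nat.card A)
    {g : A} (hg : g ∈ W) : W = Multiset.replicate W.card g := by
  rw [Multiset.eq_replicate]
  refine ⟨rfl, fun y hy => ?_⟩
  by_contra hne
  obtain ⟨W1, rfl⟩ := Multiset.exists_cons_of_mem hg
  have hy1 : y ∈ W1 := by
    rcases Multiset.mem_cons.mp hy with h | h
    · exact absurd h hne
    · exact h
  obtain ⟨W2, rfl⟩ := Multiset.exists_cons_of_mem hy1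
  induction W2 using Quotient.inductionOn with | _ l => ?_
  simp only [Multiset.quot_mk_to_coe] at *
  have h' : ZSF ((g :: y :: l : List A) : Multiset A) := h
  have := Fintype.ofFinite A
  let s : Fin (l.length + 3) → A := fun i => ((g :: y :: l).take i).sum
  have hinj : Function.Injective s := by
    intro i j hij
    rcases lt_trichotomy i j with hlt | rfl | hlt
    · exact absurd hij (h'.take_ne hlt (by have := j.2; simp; omega))
    · rfl
    · exact absurd hij.symm (h'.take_ne hlt (by have := i.2; simp; omega))
  have hb : Function.Bijective s := by
    rw [Fintype.bijective_iff_injective_and_card]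
    refine ⟨hinj, ?_⟩
    rw [Nat.card_eq_fintype_card] at hc
    simp at hc ⊢
    omega
  obtain ⟨⟨i, hi⟩, hiy⟩ := hb.2 y
  simp only [s] at hiy
  match i, hi with
  | 0, _ =>
    simp at hiy
    exact h {y} (by simp) (by simp) (by simpa using hiy.symm)
  | 1, _ =>
    simp at hiy
    exact hne hiy.symm
  | k + 2, _ =>
    simp only [List.take_succ_cons, List.sum_cons] at hiy
    refine h (g ::ₘ (l.take k : List A)) ?_ (by simp) ?_
    · apply Multiset.cons_le_cons
      exact le_trans (Multiset.coe_le.mpr (List.take_sublist _ _).subperm) (Multiset.le_cons_self _ _)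
    · have : g + (y + (List.take k l).sum) = y + (g + (List.take k l).sum) := by abel
      rw [this] at hiy
      simpa using hiy

end Generic

set_option linter.unusedSectionVars false
section Dic
open QuaternionGroup
variable {n : ℕ}

theorem half_add : (n : ZMod (2 * n)) + n = 0 := by
  have : ((2 * n : ℕ) : ZMod (2 * n)) = 0 := ZMod.natCast_self _
  push_cast at this
  rw [← this]; ring

theorem half_neg : -(n : ZMod (2 * n)) = n := neg_eq_of_add_eq_zero_left half_add

/-- doubling -/
def dbl (n : ℕ) : ZMod (2 * n) →+ ZMod (2 * n) where
  toFun x := x + x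
  map_zero' := by simp
  map_add' := by intro x y; abel

theorem dbl_apply (x : ZMod (2 * n)) : dbl n x = x + x := rfl

variable [NeZero n]

theorem half_ne : (n : ZMod (2 * n)) ≠ 0 := by
  rw [Ne, ZMod.natCast_eq_zero_iff]
  intro h
  have := Nat.le_of_dvd (Nat.pos_of_ne_zero (NeZero.ne n)) h
  have := NeZero.ne n
  omega

theorem two_tor {z : ZMod (2 * n)} (h : z + z = 0) : z = 0 ∨ z = n := by
  have h1 : ((2 * z.val : ℕ) : ZMod (2 * n)) = 0 := by
    rw [Nat.cast_mul, ZMod.natCast_zmod_val, Nat.cast_ofNat]; exact (two_mul z).trans h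
  rw [ZMod.natCast_eq_zero_iff] at h1
  have h2 : n ∣ z.val := Nat.dvd_of_mul_dvd_mul_left (by norm_num) h1
  obtain ⟨k, hk⟩ := h2
  have h3 := ZMod.val_lt z
  have hn := Nat.pos_of_ne_zero (NeZero.ne n)
  have hk2 : k < 2 := by
    by_contra hk2
    push Not at hk2
    nlinarith
  rw [← ZMod.natCast_zmod_val z, hk]
  interval_cases k
  · left; simp
  · right; simp

theorem card_ker_dbl : Nat.card (dbl n).ker = 2 := by
  have : ((dbl n).ker : Set (ZMod (2 * n))) = {0, (n : ZMod (2 * n))} := by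
    ext z
    simp only [SetLike.mem_coe, AddMonoidHom.mem_ker, Set.mem_insert_iff, Set.mem_singleton_iff,
      dbl_apply]
    constructor
    · exact two_tor
    · rintro (rfl | rfl)
      · simp
      · exact half_add
  have h2 := Set.ncard_pair (half_ne (n := n)).symm
  rw [← this] at h2
  exact h2

theorem card_range_dbl : Nat.card (dbl n).range = n := by
  have h1 := AddSubgroup.index_ker (dbl n)
  have h2 := AddSubgroup.card_mul_index (dbl n).ker
  rw [h1, card_ker_dbl, Nat.card_zmod] at h2
  omega

theorem mem_range_dbl {v : ZMod (2 * n)} : v ∈ (dbl n).range ↔ Even v := by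
  constructor
  · rintro ⟨x, rfl⟩; exact ⟨x, rfl⟩
  · rintro ⟨x, rfl⟩; exact ⟨x, rfl⟩

theorem card_comap_dbl (K : AddSubgroup (ZMod (2 * n))) :
    Nat.card (K.comap (dbl n)) ≤ 2 * Nat.card K := by
  have h1 := AddSubgroup.relIndex_ker (K.comap (dbl n)) (dbl n)
  have h2 := AddSubgroup.card_mul_index ((dbl n).ker.addSubgroupOf (K.comap (dbl n)))
  have h3 : Nat.card ((dbl n).ker.addSubgroupOf (K.comap (dbl n))) ≤ 2 := by
    refine le_trans ?_ (card_ker_dbl (n := n)).le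
    apply Nat.card_le_card_of_injective
      (fun x => (⟨x.1.1, x.2⟩ : (dbl n).ker))
    intro x y h
    have h' := congrArg (fun z : (dbl n).ker => z.1) h
    exact Subtype.ext (Subtype.ext h')
  have h4 : Nat.card ((K.comap (dbl n)).map (dbl n)) ≤ Nat.card K :=
    AddSubgroup.card_le_of_le (AddSubgroup.map_comap_le _ _)
  rw [AddSubgroup.relIndex] at h1
  rw [← h2, h1]
  exact Nat.mul_le_mul h3 h4

theorem ncard_coset (s : ZMod (2 * n)) : ({v | Even (v - s)} : Set (ZMod (2 * n))).ncard = n := by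
  have : ({v | Even (v - s)} : Set (ZMod (2 * n))) =
      Set.image (fun g => g + s) ((dbl n).range : Set (ZMod (2 * n))) := by
    ext v
    simp only [Set.mem_ofPred_eq, Set.mem_image, SetLike.mem_coe, mem_range_dbl]
    constructor
    · intro h; exact ⟨_, h, by abel⟩
    · rintro ⟨x, hx, rfl⟩; simpa using hx
  rw [this, Set.ncard_image_of_injective _ (add_left_injective s)]
  exact card_range_dbl

theorem SV_ncard_le (E : Multiset (ZMod (2 * n))) : (SV E).ncard ≤ n := by
  exact (Set.ncard_le_ncard (t := {v | Even (v - E.sum)}) (fun v hv => SV_even hv)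
    (Set.toFinite _)).trans (ncard_coset E.sum).le

theorem stb_card_le (E : Multiset (ZMod (2 * n))) : Nat.card (stb (SV E)) ≤ (SV E).ncard := by
  have := ncard_lt_add (X := ∅) (Y := SV E) (K := stb (SV E)) (by intro g _ x; simp) le_rfl
    (Set.empty_ssubset.mpr ⟨_, SV_sum_mem E⟩)
  simpa using this

theorem stb_card_pos (E : Multiset (ZMod (2 * n))) : 1 ≤ Nat.card (stb (SV E)) := Nat.card_pos

theorem not_full {E : Multiset (ZMod (2 * n))} (h : ¬ Full E) :
    (SV E).ncard + Nat.card (stb (SV E)) ≤ n ∧ 2 * Nat.card (stb (SV E)) ≤ n := by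
  constructor
  · refine le_trans (ncard_lt_add (Y := {v | Even (v - E.sum)}) le_rfl ?_ ⟨fun v hv => SV_even hv, fun hh => h fun v hv => hh hv⟩)
      (ncard_coset E.sum).le
    intro g hg x
    have := stb_even hg
    simp only [Set.mem_ofPred_eq]
    constructor
    · intro hx
      have e : x - E.sum = (x + g - E.sum) - g := by abel
      rw [e]; exact hx.sub this
    · intro hx
      have e : x + g - E.sum = (x - E.sum) + g := by abel
      rw [e]; exact hx.add this
  · have hle : stb (SV E) ≤ (dbl n).range := fun g hg => mem_range_dbl.mpr (stb_even hg)
    have hlt : ((stb (SV E) : AddSubgroup _) : Set (ZMod (2 * n))) ⊂ ((dbl n).range : Set _) := by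
      refine ⟨hle, fun hh => h (full_of_stb fun y => hh ⟨y, rfl⟩)⟩
    have := ncard_lt_add (stb_subgroup _ _ le_rfl) (stb_subgroup _ _ hle) hlt
    have h1 : ((stb (SV E) : AddSubgroup _) : Set (ZMod (2 * n))).ncard
      = Nat.card (stb (SV E)) := rfl
    have h2 : ((dbl n).range : Set (ZMod (2 * n))).ncard = Nat.card (dbl n).range := rfl
    rw [h1, h2, card_range_dbl] at this
    omega

theorem zsf_stuck_card {K : AddSubgroup (ZMod (2 * n))} {W : Multiset (ZMod (2 * n))} (h : ZSF W)
    (hW : ∀ w ∈ W, w + w ∈ K) : W.card < 2 * Nat.card K :=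
  (h.card_lt (K.comap (dbl n)) hW).trans_le (card_comap_dbl K)

end Dic

set_option linter.unusedSectionVars false
section Dic3
open QuaternionGroup
variable {n : ℕ}

/-- the sequence over the dicyclic group with exponents `C` in the cyclic part, `B` outside -/
def Sof (C B : Multiset (ZMod (2 * n))) : Multiset (QuaternionGroup n) :=
  C.map a + B.map xa

/-- underlying multiset of a multiset of pairs -/
def bs (D : Multiset (ZMod (2 * n) × ZMod (2 * n))) : Multiset (ZMod (2 * n)) :=
  D.map Prod.fst + D.map Prod.snd

/-- contribution of a pair -/
def dl (d : ZMod (2 * n) × ZMod (2 * n)) : ZMod (2 * n) := d.1 - d.2 + n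

/-- `g` is the product of some ordering of `S` -/
def Reach {G : Type*} [Group G] (S : Multiset G) (g : G) : Prop :=
  ∃ l : List G, (l : Multiset G) = S ∧ l.prod = g

theorem Reach.add {G : Type*} [Group G] {S T : Multiset G} {g h : G} (h1 : Reach S g)
    (h2 : Reach T h) : Reach (S + T) (g * h) := by
  obtain ⟨l, rfl, rfl⟩ := h1
  obtain ⟨m, rfl, rfl⟩ := h2
  exact ⟨l ++ m, by simp, by simp⟩

theorem reach_single {G : Type*} [Group G] (g : G) : Reach {g} g := ⟨[g], by simp, by simp⟩

theorem reach_a (C : Multiset (ZMod (2 * n))) : Reach (C.map a) (a C.sum) := by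
  induction C using Multiset.induction_on with
  | empty => exact ⟨[], by simp, by simp⟩
  | cons c C ih =>
    have := (reach_single (a c)).add ih
    simpa [a_mul_a] using this

theorem Sof_add (C C' B B' : Multiset (ZMod (2 * n))) :
    Sof (C + C') (B + B') = Sof C B + Sof C' B' := by
  simp only [Sof, Multiset.map_add]; abel

theorem Sof_card (C B : Multiset (ZMod (2 * n))) : (Sof C B).card = C.card + B.card := by
  simp [Sof]

theorem bs_add (D D' : Multiset (ZMod (2 * n) × ZMod (2 * n))) : bs (D + D') = bs D + bs D' := by
  simp only [bs, Multiset.map_add]; abel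

theorem bs_card (D : Multiset (ZMod (2 * n) × ZMod (2 * n))) : (bs D).card = 2 * D.card := by
  simp [bs]; omega

theorem bs_single (d : ZMod (2 * n) × ZMod (2 * n)) : bs {d} = {d.1} + {d.2} := by
  simp [bs]

theorem bs_cons (d : ZMod (2 * n) × ZMod (2 * n)) (D) : bs (d ::ₘ D) = {d.1} + {d.2} + bs D := by
  rw [← Multiset.singleton_add, bs_add, bs_single]

theorem Sof_zero : Sof (0 : Multiset (ZMod (2 * n))) 0 = 0 := rfl

theorem reach_pair (d : ZMod (2 * n) × ZMod (2 * n)) (Q : Multiset (ZMod (2 * n))) :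
    Reach (Sof Q (bs {d})) (a (dl d - Q.sum)) := by
  have := ((reach_single (xa d.2)).add (reach_a Q)).add (reach_single (xa d.1))
  rw [xa_mul_a, xa_mul_xa] at this
  have e : (n : ZMod (2 * n)) + d.1 - (d.2 + Q.sum) = dl d - Q.sum := by
    simp only [dl]; abel
  rw [e] at this
  have e2 : Sof Q (bs {d}) = {xa d.2} + Q.map a + {xa d.1} := by
    simp only [Sof, bs_single, Multiset.map_add, Multiset.map_singleton]; abel
  rwa [e2]

theorem reach_bs (D : Multiset (ZMod (2 * n) × ZMod (2 * n))) :
    Reach (Sof 0 (bs D)) (a (D.map dl).sum) := by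
  induction D using Multiset.induction_on with
  | empty => exact ⟨[], by simp [Sof, bs], by simp⟩
  | cons d D ih =>
    have := (reach_pair d 0).add ih
    rw [a_mul_a, ← Sof_add, ← bs_add] at this
    simpa using this

theorem dl_swap (d : ZMod (2 * n) × ZMod (2 * n)) : dl d.swap = - dl d := by
  have := half_neg (n := n)
  simp only [dl, Prod.fst_swap, Prod.snd_swap, neg_add, this]; abel

theorem bs_swap (d : ZMod (2 * n) × ZMod (2 * n)) : bs {d.swap} = bs {d} := by
  simp only [bs_single, Prod.fst_swap, Prod.snd_swap]; abel

theorem SV_dl {D : Multiset (ZMod (2 * n) × ZMod (2 * n))} {v : ZMod (2 * n)}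
    (h : v ∈ SV (D.map dl)) : ∃ D', bs D' = bs D ∧ D'.card = D.card ∧ (D'.map dl).sum = v := by
  induction D using Multiset.induction_on generalizing v with
  | empty => 
    rw [Multiset.map_zero, SV_zero] at h
    exact ⟨0, rfl, rfl, by simpa using h.symm⟩
  | cons d D ih =>
    rw [Multiset.map_cons, SV_cons] at h
    rcases h with h | h
    · obtain ⟨D', h1, h2, h3⟩ := ih h
      exact ⟨d ::ₘ D', by rw [bs_cons, bs_cons, h1], by simp [h2], by simp [h3]⟩
    · obtain ⟨D', h1, h2, h3⟩ := ih h
      refine ⟨d.swap ::ₘ D', ?_, by simp [h2], by simp [h3, dl_swap]⟩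
      rw [← Multiset.singleton_add, bs_add, bs_swap, ← bs_add, ← Multiset.singleton_add, bs_add,
        bs_add, h1]

theorem real1 {C : Multiset (ZMod (2 * n))} (h : C.sum = 0) : IsProductOne (Sof C 0) := by
  have := reach_a C
  rw [h] at this
  have e : Sof C 0 = C.map a := by simp [Sof]
  rw [e]
  exact this

theorem real2 {C : Multiset (ZMod (2 * n))} {D : Multiset (ZMod (2 * n) × ZMod (2 * n))}
    (hD : D ≠ 0) (h : 0 ∈ SV (C + D.map dl)) : IsProductOne (Sof C (bs D)) := by
  rw [SV_add] at h
  obtain ⟨x, ⟨P, Q, rfl, rfl⟩, y, hy, hxy⟩ := h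
  obtain ⟨D', h1, h2, rfl⟩ := SV_dl hy
  have hD' : D' ≠ 0 := by
    rw [← Multiset.card_pos, h2, Multiset.card_pos]; exact hD
  obtain ⟨d, hd⟩ := Multiset.exists_mem_of_ne_zero hD'
  obtain ⟨D'', rfl⟩ := Multiset.exists_cons_of_mem hd
  have := ((reach_a P).add (reach_pair d Q)).add (reach_bs D'')
  rw [a_mul_a, a_mul_a] at this
  have e : P.sum + (dl d - Q.sum) + (D''.map dl).sum = 0 := by
    rw [hxy]; simp only [Multiset.map_cons, Multiset.sum_cons]; abel
  rw [e] at this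
  rw [← h1]
  have e2 : Sof (P + Q) (bs (d ::ₘ D'')) = P.map a + Sof Q (bs {d}) + Sof 0 (bs D'') := by
    rw [← Multiset.singleton_add, bs_add]
    simp only [Sof, Multiset.map_add, Multiset.map_zero]; abel
  rw [e2]
  exact this

theorem exists_zip {α β : Type*} {P : Multiset α} {Q : Multiset β} (h : P.card = Q.card) :
    ∃ D : Multiset (α × β), D.map Prod.fst = P ∧ D.map Prod.snd = Q := by
  induction P using Multiset.induction_on generalizing Q with
  | empty => 
    refine ⟨0, rfl, ?_⟩
    simp only [Multiset.card_zero] at h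
    simpa using (Multiset.card_eq_zero.mp h.symm).symm
  | cons p P ih =>
    have : Q ≠ 0 := by
      rw [← Multiset.card_pos, ← h]; simp
    obtain ⟨q, hq⟩ := Multiset.exists_mem_of_ne_zero this
    obtain ⟨Q', rfl⟩ := Multiset.exists_cons_of_mem hq
    obtain ⟨D, h1, h2⟩ := ih (Q := Q') (by simpa using h)
    exact ⟨(p, q) ::ₘ D, by simp [h1], by simp [h2]⟩

theorem sum_dl (D : Multiset (ZMod (2 * n) × ZMod (2 * n))) :
    (D.map dl).sum = (D.map Prod.fst).sum - (D.map Prod.snd).sum + D.card • (n : ZMod (2 * n)) := by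
  induction D using Multiset.induction_on with
  | empty => simp
  | cons d D ih =>
    simp only [Multiset.map_cons, Multiset.sum_cons, ih, Multiset.card_cons, succ_nsmul, dl]
    abel

theorem list_form (l : List (QuaternionGroup n)) : ∃ Cp Cm Bp Bm : Multiset (ZMod (2 * n)),
    (l : Multiset _) = Sof (Cp + Cm) (Bp + Bm) ∧ (Bp + Bm = 0 → Cm = 0) ∧
    ((Bp.card = Bm.card ∧
      l.prod = a (Cp.sum - Cm.sum + Bp.sum - Bm.sum + Bm.card • (n : ZMod (2 * n)))) ∨
    (Bp.card = Bm.card + 1 ∧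
      l.prod = xa (Cp.sum - Cm.sum + Bp.sum - Bm.sum + Bm.card • (n : ZMod (2 * n))))) := by
  induction l with
  | nil => exact ⟨0, 0, 0, 0, by simp [Sof], by simp, Or.inl ⟨rfl, by simp⟩⟩
  | cons g l ih =>
    obtain ⟨Cp, Cm, Bp, Bm, h1, h2, h3⟩ := ih
    rw [← Multiset.cons_coe, h1]
    rcases g with c | b
    · rcases h3 with ⟨h3, h4⟩ | ⟨h3, h4⟩
      · refine ⟨c ::ₘ Cp, Cm, Bp, Bm, by simp [Sof], h2, Or.inl ⟨h3, ?_⟩⟩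
        rw [List.prod_cons, h4, a_mul_a]
        congr 1
        simp only [Multiset.sum_cons]; abel
      · refine ⟨Cp, c ::ₘ Cm, Bp, Bm, by simp [Sof], ?_, Or.inr ⟨h3, ?_⟩⟩
        · intro h0
          have h5 := congrArg Multiset.card h0
          rw [Multiset.card_add, Multiset.card_zero] at h5
          omega
        · rw [List.prod_cons, h4, a_mul_xa]
          congr 1
          simp only [Multiset.sum_cons]; abel
    · rcases h3 with ⟨h3, h4⟩ | ⟨h3, h4⟩
      · refine ⟨Cp, Cm, b ::ₘ Bp, Bm, by simp [Sof], by simp, Or.inr ⟨by simp [h3], ?_⟩⟩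
        rw [List.prod_cons, h4, xa_mul_a]
        congr 1
        simp only [Multiset.sum_cons]; abel
      · refine ⟨Cp, Cm, Bp, b ::ₘ Bm, by simp [Sof], by simp, Or.inl ⟨by simp [h3], ?_⟩⟩
        rw [List.prod_cons, h4, xa_mul_xa]
        congr 1
        simp only [Multiset.sum_cons, Multiset.card_cons, succ_nsmul]; abel

theorem R3 {S : Multiset (QuaternionGroup n)} (h : IsProductOne S) :
    ∃ C D, S = Sof C (bs D) ∧ 0 ∈ SV (C + D.map dl) ∧ (D = 0 → C.sum = 0) := by
  obtain ⟨l, rfl, hl⟩ := h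
  obtain ⟨Cp, Cm, Bp, Bm, h1, h2, h3⟩ := list_form l
  rcases h3 with ⟨h3, h4⟩ | ⟨h3, h4⟩
  · obtain ⟨D, rfl, rfl⟩ := exists_zip h3
    rw [hl, one_def] at h4
    have h5 := a.inj h4
    refine ⟨Cp + Cm, D, h1, ?_, ?_⟩
    · rw [SV_add]
      refine ⟨_, ⟨Cp, Cm, rfl, rfl⟩, _, SV_sum_mem _, ?_⟩
      rw [sum_dl, h5, Multiset.card_map]; abel
    · rintro rfl
      rw [h2 (by simp)] at h5 ⊢
      simpa using h5.symm
  · rw [hl, one_def] at h4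
    cases h4

/-- Every product-one decomposition lemma is used through this: minimality for `Sof`. -/
theorem Sof_inj {C C' B B' : Multiset (ZMod (2 * n))} (h : Sof C B ≤ Sof C' B') :
    C ≤ C' ∧ B ≤ B' := by
  classical
  constructor
  · rw [Multiset.le_iff_count]
    intro c
    have := Multiset.le_iff_count.mp h (a c)
    simp only [Sof, Multiset.count_add] at this
    have e : ∀ B : Multiset (ZMod (2 * n)), Multiset.count (a c) (B.map xa) = 0 := by
      intro B; rw [Multiset.count_eq_zero]; simp
    have inj : Function.Injective (a : ZMod (2 * n) → QuaternionGroup n) := fun x y h => a.inj h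
    rwa [e, e, Multiset.count_map_eq_count' _ _ inj, Multiset.count_map_eq_count' _ _ inj] at this
  · rw [Multiset.le_iff_count]
    intro c
    have := Multiset.le_iff_count.mp h (xa c)
    simp only [Sof, Multiset.count_add] at this
    have e : ∀ B : Multiset (ZMod (2 * n)), Multiset.count (xa c) (B.map a) = 0 := by
      intro B; rw [Multiset.count_eq_zero]; simp
    have inj : Function.Injective (xa : ZMod (2 * n) → QuaternionGroup n) := fun x y h => xa.inj h
    rwa [e, e, zero_add, zero_add, Multiset.count_map_eq_count' _ _ inj,
      Multiset.count_map_eq_count' _ _ inj] at this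

theorem even_dl (D : Multiset (ZMod (2 * n) × ZMod (2 * n))) :
    Even ((D.map dl).sum - ((bs D).sum + D.card • (n : ZMod (2 * n)))) := by
  refine ⟨-(D.map Prod.snd).sum, ?_⟩
  rw [sum_dl, bs, Multiset.sum_add]; abel

theorem exists_le_card {α : Type*} {k : ℕ} {R : Multiset α} (h : k ≤ R.card) :
    ∃ P ≤ R, P.card = k := by
  induction R using Quotient.inductionOn with | _ l => ?_
  simp only [Multiset.quot_mk_to_coe, Multiset.coe_card] at *
  exact ⟨(l.take k : List α), (List.take_sublist k l).subperm, by simp [h]⟩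

theorem exists_split {α : Type*} {k : ℕ} {R : Multiset α} (h : R.card = 2 * k) :
    ∃ D : Multiset (α × α), D.map Prod.fst + D.map Prod.snd = R ∧ D.card = k := by
  obtain ⟨P, hP, hc⟩ := exists_le_card (R := R) (k := k) (by omega)
  obtain ⟨Q, rfl⟩ := Multiset.le_iff_exists_add.mp hP
  rw [Multiset.card_add] at h
  obtain ⟨D, rfl, rfl⟩ := exists_zip (P := P) (Q := Q) (by omega)
  exact ⟨D, rfl, by simpa using hc⟩

theorem min_false {G : Type*} [Group G] {S T₁ T₂ : Multiset G} (h : IsMinimalProductOne S)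
    (e : S = T₁ + T₂) (h1 : T₁ ≠ 0) (h2 : T₂ ≠ 0) (p1 : IsProductOne T₁) (p2 : IsProductOne T₂) :
    False := h.2.2 _ _ h1 h2 p1 p2 e

theorem Sof_ne_left {C B : Multiset (ZMod (2 * n))} (h : C ≠ 0) : Sof C B ≠ 0 := by
  rw [← Multiset.card_pos, Sof_card]
  have := Multiset.card_pos.mpr h
  omega

theorem Sof_ne_right {C : Multiset (ZMod (2 * n))} {D : Multiset (ZMod (2 * n) × ZMod (2 * n))}
    (h : D ≠ 0) : Sof C (bs D) ≠ 0 := by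
  rw [← Multiset.card_pos, Sof_card, bs_card]
  have := Multiset.card_pos.mpr h
  omega

theorem M1 {T C : Multiset (ZMod (2 * n))} {D : Multiset (ZMod (2 * n) × ZMod (2 * n))}
    (hmin : IsMinimalProductOne (Sof (T + C) (bs D))) (hT : T ≠ 0) (hs : T.sum = 0)
    (hD : D ≠ 0) (h : 0 ∈ SV (C + D.map dl)) : False := by
  refine min_false hmin (T₁ := Sof T 0) (T₂ := Sof C (bs D)) ?_ (Sof_ne_left hT)
    (Sof_ne_right hD) (real1 hs) (real2 hD h)
  rw [← Sof_add, zero_add]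

theorem M2 {T C : Multiset (ZMod (2 * n))} {D D' : Multiset (ZMod (2 * n) × ZMod (2 * n))}
    (hmin : IsMinimalProductOne (Sof (T + C) (bs (D + D')))) 
    (hD : D ≠ 0) (hD' : D' ≠ 0) (h : 0 ∈ SV (T + D.map dl)) (h' : 0 ∈ SV (C + D'.map dl)) :
    False := by
  refine min_false hmin (T₁ := Sof T (bs D)) (T₂ := Sof C (bs D')) ?_ (Sof_ne_right hD)
    (Sof_ne_right hD') (real2 hD h) (real2 hD' h')
  rw [← Sof_add, bs_add]

theorem M3 {U W : Multiset (ZMod (2 * n))} {D1 D2 : Multiset (ZMod (2 * n) × ZMod (2 * n))}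
    {T : Multiset (QuaternionGroup n)}
    (hmin : IsMinimalProductOne (Sof (U + W) (bs (D1 + D2))))
    (h0 : 0 ∈ SV (U + W + (D1 + D2).map dl))
    (hD : D1 ≠ 0) (hF : Full (U + D1.map dl)) (hT : T ≤ Sof W (bs D2)) (hT0 : T ≠ 0)
    (hT1 : IsProductOne T) : False := by
  obtain ⟨C3, D3, rfl, h3, -⟩ := R3 hT1
  obtain ⟨hC, hB⟩ := Sof_inj hT
  obtain ⟨W', rfl⟩ := Multiset.le_iff_exists_add.mp hC
  obtain ⟨R, hR⟩ := Multiset.le_iff_exists_add.mp hB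
  have hcR := congrArg Multiset.card hR
  rw [Multiset.card_add, bs_card, bs_card] at hcR
  obtain ⟨D4, hD4, hc4⟩ := exists_split (R := R) (k := D2.card - D3.card) (by omega)
  change bs D4 = R at hD4
  subst hD4
  refine min_false hmin (T₁ := Sof C3 (bs D3)) (T₂ := Sof (U + W') (bs (D1 + D4))) ?_ hT0 ?_ hT1
    (real2 ?_ ?_)
  · rw [← Sof_add, bs_add, bs_add, hR]
    congr 1
    · abel
    · abel
  · exact Sof_ne_right (by simp [hD])
  · simp [hD]
  · have hF2 := hF.add (W' + D4.map dl)
    have e : U + W' + (D1 + D4).map dl = U + D1.map dl + (W' + D4.map dl) := by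
      rw [Multiset.map_add]; abel
    rw [e]
    apply hF2
    have e0 := SV_even h0
    have e3 := SV_even h3
    have p1 := even_dl D2
    have p3 := even_dl D3
    have p4 := even_dl D4
    have hc : D2.card = D3.card + D4.card := by omega
    rw [hR, hc, add_nsmul] at p1
    have := e0.sub e3 |>.sub (p3.add p4) |>.add p1
    convert this using 1
    simp only [Multiset.sum_add, Multiset.map_add]
    abel

end Dic3

set_option linter.unusedSectionVars false
section Dic4
open QuaternionGroup
variable {n : ℕ}

theorem le_add_split {α : Type*} {T P Q : Multiset α} (h : T ≤ P + Q) :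
    ∃ T1 T2 P' Q', T = T1 + T2 ∧ P = T1 + P' ∧ Q = T2 + Q' := by
  classical
  refine ⟨T ∩ P, T - P, P - T ∩ P, Q - (T - P), ?_, ?_, ?_⟩
  · rw [add_comm, Multiset.sub_add_inter]
  · exact (add_tsub_cancel_of_le Multiset.inter_le_right).symm
  · refine (add_tsub_cancel_of_le ?_).symm
    rw [tsub_le_iff_left]; exact h

theorem le_map_split {α β : Type*} {f : α → β} {T : Multiset β} {D : Multiset α}
    (h : T ≤ D.map f) : ∃ D1 D2, D = D1 + D2 ∧ T = D1.map f := by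
  induction T using Multiset.induction_on generalizing D with
  | empty => exact ⟨0, D, by simp, by simp⟩
  | cons t T ih =>
    have ht : t ∈ D.map f := Multiset.mem_of_le h (by simp)
    obtain ⟨d, hd, rfl⟩ := Multiset.mem_map.mp ht
    obtain ⟨D, rfl⟩ := Multiset.exists_cons_of_mem hd
    rw [Multiset.map_cons, Multiset.cons_le_cons_iff] at h
    obtain ⟨D1, D2, rfl, rfl⟩ := ih h
    exact ⟨d ::ₘ D1, D2, by simp, by simp⟩

theorem Sof_mono {C C' B B' : Multiset (ZMod (2 * n))} (h : C ≤ C') (h' : B ≤ B') :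
    Sof C B ≤ Sof C' B' := add_le_add (Multiset.map_le_map h) (Multiset.map_le_map h')

theorem exists_eq_pair {α β : Type*} {f : α → β} {B : Multiset α} (h : ¬ (B.map f).Nodup) :
    ∃ x y B', B = {x} + {y} + B' ∧ f x = f y := by
  induction B using Multiset.induction_on with
  | empty => simp at h
  | cons b B ih =>
    by_cases hb : f b ∈ B.map f
    · obtain ⟨y, hy, e⟩ := Multiset.mem_map.mp hb
      obtain ⟨B', rfl⟩ := Multiset.exists_cons_of_mem hy
      exact ⟨b, y, B', by simp, e.symm⟩
    · rw [Multiset.map_cons, Multiset.nodup_cons] at h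
      obtain ⟨x, y, B', rfl, e⟩ := ih (by tauto)
      exact ⟨x, y, b ::ₘ B', by simp, e⟩

variable [NeZero n]

theorem even_card {X : Finset (ZMod (2 * n))} (h : ∀ x ∈ X, Even x) : X.card ≤ n := by
  have := Set.ncard_le_ncard (s := (X : Set (ZMod (2 * n)))) (t := {v | Even (v - 0)})
    (fun x hx => by simpa using h x hx) (Set.toFinite _)
  rw [Set.ncard_coe_finset] at this
  exact this.trans (ncard_coset 0).le

theorem nodup_card {B : Multiset (ZMod (2 * n))} (h : (B.map (dbl n)).Nodup) : B.card ≤ n := by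
  have := even_card (X := ⟨B.map (dbl n), h⟩) (by
    intro x hx
    simp only [Finset.mem_mk, Multiset.mem_map] at hx
    obtain ⟨y, -, rfl⟩ := hx
    exact ⟨y, rfl⟩)
  simpa using this

theorem eqpair {B : Multiset (ZMod (2 * n))} (h : n + 1 ≤ B.card) :
    ∃ x y B', B = {x} + {y} + B' ∧ x + x = y + y := by
  apply exists_eq_pair (f := dbl n)
  intro hh
  have := nodup_card hh
  omega

theorem eq_dl {x y : ZMod (2 * n)} (h : x + x = y + y) : dl (x, y) = 0 ∨ dl (x, y) = n := by
  apply two_tor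
  simp only [dl]
  have := half_add (n := n)
  have e : x - y + n + (x - y + (n : ZMod (2 * n))) = (x + x) - (y + y) + (n + n) := by abel
  rw [e, h, this]; simp

theorem T_of_D {D : Multiset (ZMod (2 * n) × ZMod (2 * n))} {C : Multiset (ZMod (2 * n))}
    (C' B') (hD : D ≠ 0) (h : 0 ∈ SV (C + D.map dl)) (hC : C ≤ C') (hB : bs D ≤ B') :
    ∃ T ≤ Sof C' B', T ≠ 0 ∧ IsProductOne T :=
  ⟨Sof C (bs D), Sof_mono hC hB, Sof_ne_right hD, real2 hD h⟩

theorem twopair {x y x' y' : ZMod (2 * n)} (h : x + x = y + y) (h' : x' + x' = y' + y')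
    (C B : Multiset (ZMod (2 * n))) (hB : {x} + {y} + ({x'} + {y'}) ≤ B) :
    ∃ T ≤ Sof C B, T ≠ 0 ∧ IsProductOne T := by
  rcases eq_dl h with h1 | h1
  · refine T_of_D (D := {(x, y)}) (C := 0) C B (by simp) ?_ (by simp) ?_
    · simp [SV_single, h1]
    · rw [bs_single]; exact le_trans (Multiset.le_add_right _ _) hB
  rcases eq_dl h' with h2 | h2
  · refine T_of_D (D := {(x', y')}) (C := 0) C B (by simp) ?_ (by simp) ?_
    · simp [SV_single, h2]
    · rw [bs_single]; exact le_trans (Multiset.le_add_left _ _) hB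
  refine T_of_D (D := {(x, y)} + {(x', y')}) (C := 0) C B (by simp) ?_ (by simp) ?_
  · have := SV_sum_mem (0 + ({(x, y)} + {(x', y')} : Multiset _).map dl)
    simp only [zero_add, Multiset.map_add, Multiset.map_singleton, h1, h2, Multiset.sum_add,
      Multiset.sum_singleton, half_add] at this
    simpa [h1, h2] using this
  · rw [bs_add, bs_single, bs_single]; exact hB

theorem B1 {B : Multiset (ZMod (2 * n))} (h : n + 3 ≤ B.card) (C : Multiset (ZMod (2 * n))) :
    ∃ T ≤ Sof C B, T ≠ 0 ∧ IsProductOne T := by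
  obtain ⟨x, y, B', rfl, e⟩ := eqpair (B := B) (by omega)
  simp only [Multiset.card_add, Multiset.card_singleton] at h
  obtain ⟨x', y', B'', rfl, e'⟩ := eqpair (B := B') (by omega)
  refine twopair e e' _ _ ?_
  exact add_le_add le_rfl (Multiset.le_add_right _ _)

theorem B2 (hn : 3 ≤ n) {B : Multiset (ZMod (2 * n))} (h : n + 1 ≤ B.card)
    {C : Multiset (ZMod (2 * n))} (hC : C ≠ 0) :
    ∃ T ≤ Sof C B, T ≠ 0 ∧ IsProductOne T := by
  classical
  obtain ⟨c, hc⟩ := Multiset.exists_mem_of_ne_zero hC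
  have hcC : {c} ≤ C := Multiset.singleton_le.mpr hc
  obtain ⟨x, y, B', rfl, e⟩ := eqpair (B := B) (by omega)
  simp only [Multiset.card_add, Multiset.card_singleton] at h
  rcases eq_dl e with h1 | h1
  · refine T_of_D (D := {(x, y)}) (C := 0) C _ (by simp) ?_ (by simp) ?_
    · simp [SV_single, h1]
    · rw [bs_single]; exact Multiset.le_add_right _ _
  by_cases hc2 : c + c = 0
  · rcases two_tor hc2 with rfl | rfl
    · exact ⟨Sof {0} 0, Sof_mono hcC (by simp), Sof_ne_left (by simp), real1 (by simp)⟩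
    · refine T_of_D (D := {(x, y)}) (C := {(n : ZMod (2 * n))}) C _ (by simp) ?_ hcC ?_
      · rw [SV_add]
        refine ⟨n, by simp [SV_single], n, by simp [SV_single, h1], half_add.symm⟩
      · rw [bs_single]; exact Multiset.le_add_right _ _
  by_cases hnd : (B'.map (dbl n)).Nodup
  swap
  · obtain ⟨x', y', B'', rfl, e'⟩ := exists_eq_pair hnd
    refine twopair e e' _ _ ?_
    exact add_le_add le_rfl (Multiset.le_add_right _ _)
  let X : Finset (ZMod (2 * n)) := ⟨B'.map (dbl n), hnd⟩
  have hX : ∀ z ∈ X, ∃ y ∈ B', z = y + y := by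
    intro z hz
    simp only [X, Finset.mem_mk, Multiset.mem_map] at hz
    obtain ⟨y, hy, rfl⟩ := hz
    exact ⟨y, hy, rfl⟩
  have hXc : X.card = B'.card := by simp [X]
  let Y : Finset (ZMod (2 * n)) := X.image (fun z => z + (c + c))
  have hYc : Y.card = B'.card := by
    rw [Finset.card_image_of_injective _ (add_left_injective _), hXc]
  have hnon : ¬ Disjoint X Y := by
    intro hdis
    have h2 := Finset.card_union_of_disjoint hdis
    have h3 := even_card (X := X ∪ Y) (by
      intro z hz
      rw [Finset.mem_union] at hz
      rcases hz with hz | hz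
      · obtain ⟨y, -, rfl⟩ := hX z hz
        exact ⟨y, rfl⟩
      · obtain ⟨w, hw, rfl⟩ := Finset.mem_image.mp hz
        obtain ⟨y, -, rfl⟩ := hX w hw
        exact ⟨y + c, by abel⟩)
    omega
  rw [Finset.not_disjoint_iff] at hnon
  obtain ⟨z, hz1, hz2⟩ := hnon
  obtain ⟨w, hw, rfl⟩ := Finset.mem_image.mp hz2
  obtain ⟨v, hv, rfl⟩ := hX w hw
  obtain ⟨u, hu, e2⟩ := hX _ hz1
  have huv : u ≠ v := by
    rintro rfl
    exact hc2 (by simpa using e2)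
  obtain ⟨B1, rfl⟩ := Multiset.exists_cons_of_mem hu
  have hv1 : v ∈ B1 := by
    rcases Multiset.mem_cons.mp hv with h | h
    · exact absurd h.symm huv
    · exact h
  obtain ⟨B2, rfl⟩ := Multiset.exists_cons_of_mem hv1
  have hle : bs {(u, v)} ≤ u ::ₘ v ::ₘ B2 := by
    rw [bs_single, ← Multiset.singleton_add u, ← Multiset.singleton_add v, ← add_assoc]
    exact Multiset.le_add_right _ _
  have hz : (dl (u, v) - c) + (dl (u, v) - c) = 0 := by
    have := half_add (n := n)
    simp only [dl]
    have e3 : u - v + (n : ZMod (2 * n)) - c + (u - v + n - c) =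
      (u + u) - (v + v + (c + c)) + (n + n) := by abel
    rw [e3, ← e2, this]; simp
  rcases two_tor hz with hz | hz
  · refine T_of_D (D := {(u, v)}) (C := {c}) C _ (by simp) ?_ hcC ?_
    · rw [SV_add]
      refine ⟨-c, by simp [SV_single], dl (u, v), by simp [SV_single], ?_⟩
      rw [← hz]; abel
    · exact hle.trans (Multiset.le_add_left _ _)
  · refine T_of_D (D := {(x, y)} + {(u, v)}) (C := {c}) C _ (by simp) ?_ hcC ?_
    · rw [SV_add]
      refine ⟨-c, by simp [SV_single], dl (x, y) + dl (u, v), ?_, ?_⟩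
      · have := SV_sum_mem (({(x, y)} + {(u, v)} : Multiset _).map dl)
        simpa only [Multiset.map_add, Multiset.map_singleton, Multiset.sum_add,
          Multiset.sum_singleton] using this
      · rw [h1, eq_add_of_sub_eq hz]
        have := half_add (n := n)
        rw [← this]; abel
    · rw [bs_add, bs_single]
      exact add_le_add le_rfl hle

theorem lemS {U Wc : Multiset (ZMod (2 * n))} {D0 D' : Multiset (ZMod (2 * n) × ZMod (2 * n))}
    (hmin : IsMinimalProductOne (Sof (U + Wc) (bs (D0 + D'))))
    (h0 : 0 ∈ SV (U + Wc + (D0 + D').map dl)) (hD0 : D0 ≠ 0)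
    (hW : ∀ w ∈ Wc, w + w ∈ stb (SV (U + D0.map dl)))
    (hc : 3 * n ≤ 2 * (Wc.card + D'.card + (SV (U + D0.map dl)).ncard) + 1) :
    ∃ Ud Wd, D' = Ud + Wd ∧ Full (U + (D0 + Ud).map dl) ∧
      (SV (U + D0.map dl)).ncard + Ud.card * Nat.card (stb (SV (U + D0.map dl))) ≤ n := by
  obtain ⟨Ud, Wd, rfl, hWd, hcount⟩ := greedy dl _ (U + D0.map dl) D' le_rfl
  refine ⟨Ud, Wd, rfl, ?_, hcount.trans (SV_ncard_le _)⟩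
  by_contra hF
  have eE : U + (D0 + Ud).map dl = U + D0.map dl + Ud.map dl := by
    rw [Multiset.map_add, add_assoc]
  rw [eE] at hF
  set E := U + D0.map dl + Ud.map dl with hE
  obtain ⟨h1, h2⟩ := not_full hF
  have hst : ∀ w ∈ Wc + Wd.map dl, w + w ∈ stb (SV E) := by
    intro w hw
    rcases Multiset.mem_add.mp hw with hw | hw
    · exact stb_mono _ _ (hW w hw)
    · obtain ⟨d, hd, rfl⟩ := Multiset.mem_map.mp hw
      exact hWd d hd
  have hz : ZSF (Wc + Wd.map dl) := by
    intro T hT hT0 hTs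
    obtain ⟨T1, T2, W1, Q, rfl, rfl, hq⟩ := le_add_split hT
    obtain ⟨D1, D2, rfl, rfl⟩ := le_map_split (f := dl) (T := T2) (D := Wd)
      (by rw [hq]; exact Multiset.le_add_right _ _)
    have h3 := SV_stuck (E := E) (T := T1 + D1.map dl) (F := W1 + D2.map dl) (v := 0)
      (fun w hw => hst w (Multiset.mem_of_le hT hw)) hTs (by
        convert h0 using 2
        simp only [hE, Multiset.map_add]; abel)
    by_cases hD1 : D1 = 0
    · subst hD1
      refine M1 (T := T1) (C := U + W1) (D := D0 + (Ud + D2)) ?_ (by simpa using hT0)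
        (by simpa using hTs) (by simp [hD0]) ?_
      · convert hmin using 2
        · abel
        · simp
      · convert h3 using 2
        simp only [hE, Multiset.map_add]; abel
    · refine M2 (T := T1) (C := U + W1) (D := D1) (D' := D0 + (Ud + D2)) ?_ hD1 (by simp [hD0]) 
        ?_ ?_
      · convert hmin using 2
        · abel
        · congr 1; abel
      · have := SV_sum_mem (T1 + D1.map dl)
        rwa [hTs] at this
      · convert h3 using 2
        simp only [hE, Multiset.map_add]; abel
  have h4 := zsf_stuck_card hz hst
  have h5 := stb_card_pos (U + D0.map dl)
  have h6 : Ud.card ≤ Ud.card * Nat.card (stb (SV (U + D0.map dl))) :=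
    Nat.le_mul_of_pos_right _ h5
  simp only [Multiset.card_add, Multiset.card_map] at h4 hc
  omega

end Dic4

set_option linter.unusedSectionVars false
section Dic5
open QuaternionGroup
variable {n : ℕ}

theorem M3' {C U W : Multiset (ZMod (2 * n))} {D D1 D2 : Multiset (ZMod (2 * n) × ZMod (2 * n))}
    (hmin : IsMinimalProductOne (Sof C (bs D))) (h0 : 0 ∈ SV (C + D.map dl))
    (eC : C = U + W) (eD : D = D1 + D2)
    (hD : D1 ≠ 0) (hF : Full (U + D1.map dl))
    (hT : ∃ T ≤ Sof W (bs D2), T ≠ 0 ∧ IsProductOne T) : False := by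
  subst eC eD
  obtain ⟨T, h1, h2, h3⟩ := hT
  exact M3 hmin h0 hD hF h1 h2 h3

theorem triv {C : Multiset (ZMod (2 * n))} {D D1 D2 : Multiset (ZMod (2 * n) × ZMod (2 * n))}
    (hmin : IsMinimalProductOne (Sof C (bs D))) (h0 : 0 ∈ SV (C + D.map dl))
    (eD : D = D1 + D2) (hD1 : D1 ≠ 0) (hD2 : D2 ≠ 0) (ht : ∀ d ∈ D1, dl d + dl d = 0)
    (hs : (D1.map dl).sum = 0) : False := by
  subst eD
  have h1 := SV_stuck (E := 0) (T := D1.map dl) (F := C + D2.map dl) (v := 0) (by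
    intro w hw
    obtain ⟨d, hd, rfl⟩ := Multiset.mem_map.mp hw
    rw [ht d hd]; exact zero_mem _) hs (by
    convert h0 using 2
    rw [Multiset.map_add]; abel)
  rw [zero_add] at h1
  refine M2 (T := 0) (C := C) (by rwa [zero_add]) hD1 hD2 ?_ h1
  have := SV_sum_mem (D1.map dl)
  rwa [hs, ← zero_add (D1.map dl)] at this

variable [NeZero n]

theorem triv2 {C : Multiset (ZMod (2 * n))} {d d'} {D D2 : Multiset (ZMod (2 * n) × ZMod (2 * n))}
    (hmin : IsMinimalProductOne (Sof C (bs D))) (h0 : 0 ∈ SV (C + D.map dl))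
    (eD : D = {d} + {d'} + D2) (hD2 : D2 ≠ 0) (h : dl d + dl d = 0) (h' : dl d' + dl d' = 0) :
    False := by
  rcases two_tor h with h1 | h1
  · exact triv hmin h0 (D1 := {d}) (D2 := {d'} + D2) (by rw [eD, add_assoc]) (by simp) (by simp)
      (by simpa using h) (by simpa using h1)
  rcases two_tor h' with h2 | h2
  · exact triv hmin h0 (D1 := {d'}) (D2 := {d} + D2) (by rw [eD]; abel) (by simp) (by simp)
      (by simpa using h') (by simpa using h2)
  refine triv hmin h0 (D1 := {d} + {d'}) eD (by simp) hD2 ?_ ?_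
  · intro e he
    simp only [Multiset.mem_add, Multiset.mem_singleton] at he
    rcases he with rfl | rfl <;> assumption
  · simp only [Multiset.map_add, Multiset.map_singleton, Multiset.sum_add, Multiset.sum_singleton,
      h1, h2, half_add]

theorem SV_single_eq (x : ZMod (2 * n)) : SV ({x} : Multiset (ZMod (2 * n))) = {x, -x} := by
  ext v; rw [SV_single]; simp

theorem ncard_single {x : ZMod (2 * n)} (h : x + x ≠ 0) :
    (SV ({x} : Multiset (ZMod (2 * n)))).ncard = 2 := by
  rw [SV_single_eq, Set.ncard_pair]
  intro e
  exact h (by nth_rewrite 2 [e]; simp)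

theorem ncard_pos (E : Multiset (ZMod (2 * n))) : 1 ≤ (SV E).ncard :=
  (Set.ncard_pos (Set.toFinite _)).mpr ⟨_, SV_sum_mem E⟩

theorem ncard_two {x y : ZMod (2 * n)} (hx : x + x ≠ 0) (hy : y + y ≠ 0) (h1 : y + y ≠ x + x)
    (h2 : y + y ≠ -(x + x)) : (SV ({x} + {y} : Multiset (ZMod (2 * n)))).ncard = 4 := by
  classical
  have e : SV ({x} + {y} : Multiset (ZMod (2 * n))) =
      (({x + y, x - y, -x + y, -x - y} : Finset (ZMod (2 * n))) : Set (ZMod (2 * n))) := by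
    ext v
    rw [SV_add]
    simp only [SV_single]
    push_cast
    simp only [Set.mem_insert_iff, Set.mem_singleton_iff]
    constructor
    · rintro ⟨a, rfl | rfl, b, rfl | rfl, rfl⟩ <;> simp [sub_eq_add_neg]
    · rintro (rfl | rfl | rfl | rfl)
      · exact ⟨x, by simp, y, by simp, rfl⟩
      · exact ⟨x, by simp, -y, by simp, by abel⟩
      · exact ⟨-x, by simp, y, by simp, rfl⟩
      · exact ⟨-x, by simp, -y, by simp, by abel⟩
  rw [e, Set.ncard_coe_finset]
  have d12 : x + y ≠ x - y := fun h => hy (by linear_combination h)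
  have d13 : x + y ≠ -x + y := fun h => hx (by linear_combination h)
  have d14 : x + y ≠ -x - y := fun h => h2 (by linear_combination h)
  have d23 : x - y ≠ -x + y := fun h => h1 (by linear_combination -h)
  have d24 : x - y ≠ -x - y := fun h => hx (by linear_combination h)
  have d34 : -x + y ≠ -x - y := fun h => hy (by linear_combination h)
  rw [Finset.card_insert_of_notMem (by simp [d12, d13, d14]),
    Finset.card_insert_of_notMem (by simp only [Finset.mem_insert, Finset.mem_singleton]; tauto),
    Finset.card_insert_of_notMem (by simp only [Finset.mem_singleton]; tauto),
    Finset.card_singleton]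

theorem phase1 {C : Multiset (ZMod (2 * n))} {d1} {D D' : Multiset (ZMod (2 * n) × ZMod (2 * n))}
    (hmin : IsMinimalProductOne (Sof C (bs D))) (h0 : 0 ∈ SV (C + D.map dl))
    (eD : D = {d1} + D') :
    ∃ U W, C = U + W ∧
      (∀ w ∈ W, w + w ∈ stb (SV (U + Multiset.map dl {d1}))) ∧
      (SV {dl d1}).ncard + U.card ≤ (SV (U + Multiset.map dl {d1})).ncard ∧ ZSF W ∧
      W.card < 2 * Nat.card (stb (SV (U + Multiset.map dl {d1}))) := by
  obtain ⟨U, W, rfl, hW, hc⟩ := greedy id 1 {dl d1} C (stb_card_pos _)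
  have e : ({dl d1} : Multiset (ZMod (2 * n))) + U.map id = U + Multiset.map dl {d1} := by
    simp [add_comm]
  rw [e] at hc hW
  simp only [id] at hW
  rw [mul_one] at hc
  have hz : ZSF W := by
    intro T hT hT0 hTs
    obtain ⟨W', rfl⟩ := Multiset.le_iff_exists_add.mp hT
    have h3 := SV_stuck (E := U + Multiset.map dl {d1}) (T := T) (F := W' + D'.map dl) (v := 0)
      (fun w hw => hW w (Multiset.mem_of_le hT hw)) hTs (by
        convert h0 using 2
        simp only [eD, Multiset.map_add]; abel)
    refine M1 (T := T) (C := U + W') (D := D) ?_ hT0 hTs (by simp [eD]) ?_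
    · convert hmin using 2
      abel
    · convert h3 using 2
      simp only [eD, Multiset.map_add]; abel
  exact ⟨U, W, rfl, hW, hc, hz, zsf_stuck_card hz hW⟩

theorem signed_T {W : Multiset (ZMod (2 * n))} {d} {D : Multiset (ZMod (2 * n) × ZMod (2 * n))}
    (hz : ZSF W) (hW : n ≤ W.card) (hd : d ∈ D) :
    ∃ T ≤ Sof W (bs D), T ≠ 0 ∧ IsProductOne T := by
  obtain ⟨T, W', rfl, h⟩ := hz.signed (by rw [Nat.card_zmod]; omega) (dl d)
  obtain ⟨D, rfl⟩ := Multiset.exists_cons_of_mem hd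
  refine T_of_D (D := {d}) (C := T) _ _ (by simp) (by simpa using h) (Multiset.le_add_right _ _) ?_
  rw [← Multiset.singleton_add, bs_add]; exact Multiset.le_add_right _ _

theorem caseA (hn : 3 ≤ n) {C : Multiset (ZMod (2 * n))} {d1 d2}
    {D : Multiset (ZMod (2 * n) × ZMod (2 * n))}
    (hmin : IsMinimalProductOne (Sof C (bs D))) (h0 : 0 ∈ SV (C + D.map dl))
    (hc : C.card + 2 * D.card = 3 * n) (eD : D = {d1} + {d2}) : False := by
  obtain ⟨U, W, rfl, hW, h1, hz, h2⟩ := phase1 hmin h0 eD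
  have h3 := ncard_pos ({dl d1} : Multiset (ZMod (2 * n)))
  have h4 := SV_ncard_le (U + Multiset.map dl {d1})
  have h5 : D.card = 2 := by rw [eD]; simp
  rw [Multiset.card_add] at hc
  by_cases hF : Full (U + Multiset.map dl {d1})
  · exact M3' hmin h0 rfl eD (by simp) hF (signed_T hz (by omega) (d := d2) (by simp))
  · obtain ⟨h6, h7⟩ := not_full hF
    omega

theorem dic_residual {D : Multiset (ZMod (2 * n) × ZMod (2 * n))} (hn : 3 ≤ n)
    (hmin : IsMinimalProductOne (Sof 0 (bs D))) (h0 : 0 ∈ SV (0 + D.map dl))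
    (hc : 2 * D.card = 3 * n) : False := by
  rw [zero_add] at h0
  obtain ⟨D₁, hb, hk, hs⟩ := SV_dl h0
  rw [← hb] at hmin
  rw [← hk] at hc
  clear h0 hb hk D
  obtain ⟨b, b', P, hP, eb⟩ := eqpair (B := D₁.map Prod.fst) (by rw [Multiset.card_map]; omega)
  obtain ⟨g, g', Q, hQ, eg⟩ := eqpair (B := D₁.map Prod.snd) (by rw [Multiset.card_map]; omega)
  have cP := congrArg Multiset.card hP
  have cQ := congrArg Multiset.card hQ
  simp only [Multiset.card_map, Multiset.card_add, Multiset.card_singleton] at cP cQ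
  obtain ⟨D3, rfl, rfl⟩ := exists_zip (P := P) (Q := Q) (by omega)
  rw [Multiset.card_map] at cP cQ
  obtain ⟨D, eD⟩ : ∃ D, D = {(b, g)} + {(b', g')} + D3 := ⟨_, rfl⟩
  have eF : D.map Prod.fst = D₁.map Prod.fst := by rw [hP, eD]; simp
  have eS : D.map Prod.snd = D₁.map Prod.snd := by rw [hQ, eD]; simp
  have ec : D.card = D₁.card := by
    have := congrArg Multiset.card eF
    simpa using this
  have h0 : 0 ∈ SV (0 + D.map dl) := by
    have := SV_sum_mem (D.map dl)
    rw [sum_dl, eF, eS, ec, ← sum_dl, hs] at this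
    rwa [zero_add]
  have hbs : bs D = bs D₁ := by rw [bs, bs, eF, eS]
  rw [← hbs] at hmin
  rw [← ec] at hc cP
  clear cQ ec hbs eF eS hP hQ hs
  -- a nontrivial pair
  have hex : ∃ d ∈ D3, dl d + dl d ≠ 0 := by
    by_contra hex
    push Not at hex
    obtain ⟨P, hP, hPc⟩ := exists_le_card (R := D3) (k := 2) (by omega)
    obtain ⟨Q, rfl⟩ := Multiset.le_iff_exists_add.mp hP
    obtain ⟨d1, d2, rfl⟩ := Multiset.card_eq_two.mp hPc
    refine triv2 (d := d1) (d' := d2) (D2 := {(b, g)} + {(b', g')} + Q) hmin h0 ?_ (by simp)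
      (hex _ (by simp)) (hex _ (by simp))
    rw [eD]
    change _ + ({d1} + {d2} + Q) = _
    abel
  obtain ⟨d1, hd1, hne⟩ := hex
  obtain ⟨D4, rfl⟩ := Multiset.exists_cons_of_mem hd1
  rw [Multiset.card_cons] at cP
  obtain ⟨R, hR⟩ : ∃ R, R = {(b, g)} + {(b', g')} + D4 := ⟨_, rfl⟩
  have eD2 : D = {d1} + R := by
    rw [eD, hR, ← Multiset.singleton_add]; abel
  have cR : D.card = R.card + 1 := by rw [eD2]; simp [add_comm]
  have claim : ∀ d ∈ R, dl d + dl d ≠ 0 → dl d + dl d = dl d1 + dl d1 ∨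
      dl d + dl d = -(dl d1 + dl d1) := by
    intro d hd hdne
    by_contra hcon
    push Not at hcon
    obtain ⟨R', rfl⟩ := Multiset.exists_cons_of_mem hd
    rw [Multiset.card_cons] at cR
    have h4 := ncard_two hne hdne hcon.1 hcon.2
    have eD3 : D = {d1} + {d} + R' := by rw [eD2, ← Multiset.singleton_add, add_assoc]
    have e4 : (0 : Multiset (ZMod (2 * n))) + Multiset.map dl ({d1} + {d}) = {dl d1} + {dl d} := by
      simp
    obtain ⟨Ud, Wd, rfl, hF, h5⟩ := lemS (U := 0) (Wc := 0) (D0 := {d1} + {d}) (D' := R')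
      (by rw [← eD3]; exact hmin) (by rw [← eD3]; exact h0) (by simp) (by simp)
      (by rw [e4, h4, Multiset.card_zero]; omega)
    rw [e4, h4] at h5
    refine M3' hmin h0 (zero_add 0).symm (D1 := {d1} + {d} + Ud) (D2 := Wd)
      (by rw [eD3]; abel) (by simp) hF (B1 ?_ _)
    rw [bs_card]
    have h6 := stb_card_pos (({dl d1} + {dl d} : Multiset (ZMod (2 * n))))
    have h7 : Ud.card ≤ Ud.card * _ := Nat.le_mul_of_pos_right _ h6
    rw [Multiset.card_add] at cR
    omega
  have h2x : ∀ d ∈ R, dl d + dl d ∈ AddSubgroup.zmultiples (dl d1 + dl d1) := by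
    intro d hd
    by_cases hz : dl d + dl d = 0
    · rw [hz]; exact zero_mem _
    · rcases claim d hd hz with h | h
      · rw [h]; exact AddSubgroup.mem_zmultiples _
      · rw [h]; exact neg_mem (AddSubgroup.mem_zmultiples _)
  have e1 : (0 : Multiset (ZMod (2 * n))) + Multiset.map dl {d1} = {dl d1} := by simp
  have hall : ∀ y : ZMod (2 * n), y + y ∈ AddSubgroup.zmultiples (dl d1 + dl d1) := by
    obtain ⟨Ud, Wd, rfl, hF, h5⟩ := lemS (U := 0) (Wc := 0) (D0 := {d1}) (D' := R)
      (by rw [← eD2]; exact hmin) (by rw [← eD2]; exact h0) (by simp) (by simp)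
      (by rw [e1, ncard_single hne, Multiset.card_zero]; omega)
    intro y
    have h6 := hF ((0 + Multiset.map dl ({d1} + Ud)).sum + (y + y)) ⟨y, by simp⟩
    have h7 := SV_stuck1 (K := AddSubgroup.zmultiples (dl d1 + dl d1)) ?_ h6
    · simpa using h7
    · intro w hw
      rw [zero_add] at hw
      obtain ⟨d, hd, rfl⟩ := Multiset.mem_map.mp hw
      simp only [Multiset.mem_add, Multiset.mem_singleton] at hd
      rcases hd with rfl | hd
      · exact AddSubgroup.mem_zmultiples _
      · exact h2x d (Multiset.mem_add.mpr (Or.inl hd))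
  obtain ⟨U, W, rfl, hW, hcount⟩ := greedy dl 1 {dl d1} D4 (stb_card_pos _)
  have e5 : (0 : Multiset (ZMod (2 * n))) + Multiset.map dl ({d1} + U) = {dl d1} + U.map dl := by
    simp
  have hF : Full (0 + Multiset.map dl ({d1} + U)) := by
    rw [e5]
    by_cases hw : ∃ w ∈ W, dl w + dl w ≠ 0
    · obtain ⟨w, hwW, hwne⟩ := hw
      have h1 := hW w hwW
      have h2 : dl d1 + dl d1 ∈ stb (SV ({dl d1} + U.map dl)) := by
        rcases claim w (by rw [hR]; simp [hwW]) hwne with h | h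
        · rwa [← h]
        · have := neg_mem h1
          rwa [h, neg_neg] at this
      apply full_of_stb
      intro y
      exact (AddSubgroup.zmultiples_le_of_mem h2) (hall y)
    · push Not at hw
      by_contra hF
      have h1 := (not_full hF).1
      have h2 := stb_card_pos ({dl d1} + U.map dl)
      rw [ncard_single hne] at hcount
      have hW1 : W.card ≤ 1 := by
        by_contra hW1
        obtain ⟨P, hP, hPc⟩ := exists_le_card (R := W) (k := 2) (by omega)
        obtain ⟨Q, rfl⟩ := Multiset.le_iff_exists_add.mp hP
        obtain ⟨t1, t2, rfl⟩ := Multiset.card_eq_two.mp hPc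
        refine triv2 (d := t1) (d' := t2) (D2 := {d1} + ({(b, g)} + {(b', g')} + (U + Q)))
          hmin h0 ?_ (by simp) (hw _ (by simp)) (hw _ (by simp))
        rw [eD2, hR]
        change _ + (_ + (U + ({t1} + {t2} + Q))) = _
        abel
      rw [Multiset.card_add] at cP
      omega
  refine M3' hmin h0 (zero_add 0).symm (D1 := {d1} + U) (D2 := {(b, g)} + {(b', g')} + W)
    (by rw [eD2, hR]; abel) (by simp) hF (twopair eb eg _ _ ?_)
  rw [bs_add, bs_add, bs_single, bs_single]
  refine le_trans (le_of_eq ?_) (Multiset.le_add_right _ _)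
  abel

theorem caseB (hn : 3 ≤ n) {C : Multiset (ZMod (2 * n))} {d1}
    {D D' : Multiset (ZMod (2 * n) × ZMod (2 * n))}
    (hmin : IsMinimalProductOne (Sof C (bs D))) (h0 : 0 ∈ SV (C + D.map dl))
    (hc : C.card + 2 * D.card = 3 * n) (eD : D = {d1} + D') (hD' : D' ≠ 0)
    (hd : dl d1 + dl d1 ≠ 0) : False := by
  by_cases hC0 : C = 0
  · subst hC0
    exact dic_residual hn hmin h0 (by simpa using hc)
  obtain ⟨U, W, rfl, hW, h1, hz, h2⟩ := phase1 hmin h0 eD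
  rw [ncard_single hd] at h1
  have h4 := SV_ncard_le (U + Multiset.map dl {d1})
  have h5 : D.card = D'.card + 1 := by rw [eD]; simp [add_comm]
  rw [Multiset.card_add] at hc
  by_cases hF : Full (U + Multiset.map dl {d1})
  · refine M3' hmin h0 rfl eD (by simp) hF ?_
    by_cases hg : n ≤ W.card
    · obtain ⟨d2, hd2⟩ := Multiset.exists_mem_of_ne_zero hD'
      exact signed_T hz hg hd2
    · by_cases hW0 : W = 0
      · subst hW0
        rw [Multiset.card_zero] at hc
        exact B1 (by rw [bs_card]; omega) _
      · exact B2 hn (by rw [bs_card]; omega) hW0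
  · obtain ⟨h6, h7⟩ := not_full hF
    have h8 := stb_card_le (U + Multiset.map dl {d1})
    have h8' := stb_card_pos (U + Multiset.map dl {d1})
    subst eD
    obtain ⟨Ud, Wd, rfl, hF2, h9⟩ := lemS hmin h0 (by simp) hW (by omega)
    simp only [Multiset.card_add, Multiset.card_singleton] at h5 hc
    refine M3' hmin h0 rfl (add_assoc _ _ _).symm (by simp) hF2 ?_
    generalize (SV (U + Multiset.map dl {d1})).ncard = v at *
    generalize Nat.card (stb (SV (U + Multiset.map dl {d1}))) = m at *
    by_cases hW0 : W = 0
    · subst hW0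
      have hU0 : 1 ≤ U.card := Multiset.card_pos.mpr (by simpa using hC0)
      refine B1 ?_ _
      rw [bs_card]
      rw [Multiset.card_zero] at hc h2
      by_cases hm : m = 1
      · subst hm
        omega
      · have : Ud.card * 2 ≤ Ud.card * m := Nat.mul_le_mul_left _ (by omega)
        omega
    · refine B2 hn ?_ hW0
      have hW1 := Multiset.card_pos.mpr hW0
      rw [bs_card]
      by_cases hm : m = 1
      · subst hm
        omega
      · have : Ud.card * 2 ≤ Ud.card * m := Nat.mul_le_mul_left _ (by omega)
        omega

theorem main_k2 (hn : 3 ≤ n) {C : Multiset (ZMod (2 * n))}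
    {D : Multiset (ZMod (2 * n) × ZMod (2 * n))}
    (hmin : IsMinimalProductOne (Sof C (bs D))) (h0 : 0 ∈ SV (C + D.map dl))
    (hc : C.card + 2 * D.card = 3 * n) (hk : 2 ≤ D.card) : False := by
  by_cases hex : ∃ d ∈ D, dl d + dl d ≠ 0
  · obtain ⟨d, hd, hne⟩ := hex
    obtain ⟨D', rfl⟩ := Multiset.exists_cons_of_mem hd
    refine caseB hn hmin h0 hc (Multiset.singleton_add _ _).symm ?_ hne
    rw [← Multiset.card_pos]
    rw [Multiset.card_cons] at hk
    omega
  · push Not at hex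
    obtain ⟨P, hP, hPc⟩ := exists_le_card hk
    obtain ⟨Q, rfl⟩ := Multiset.le_iff_exists_add.mp hP
    obtain ⟨d1, d2, rfl⟩ := Multiset.card_eq_two.mp hPc
    have e : ({d1, d2} : Multiset (ZMod (2 * n) × ZMod (2 * n))) = {d1} + {d2} := rfl
    rw [e] at *
    by_cases hQ : Q = 0
    · subst hQ
      exact caseA hn hmin h0 hc (add_zero _)
    · exact triv2 hmin h0 rfl hQ (hex _ (by simp)) (hex _ (by simp))

end Dic5

set_option linter.unusedSectionVars false
section Dic6
open QuaternionGroup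
variable {n : ℕ} [NeZero n]

theorem zsf_card {W : Multiset (ZMod (2 * n))} (h : ZSF W) : W.card < 2 * n := by
  have := h.card_lt ⊤ (by simp)
  rwa [AddSubgroup.card_top, Nat.card_zmod] at this

theorem main_k0 (hn : 2 ≤ n) {C : Multiset (ZMod (2 * n))}
    (hmin : IsMinimalProductOne (Sof C 0)) (hs : C.sum = 0) (hc : C.card = 3 * n) : False := by
  obtain ⟨W, hW, hWc⟩ := exists_le_card (R := C) (k := 3 * n - 1) (by omega)
  have hz : ¬ ZSF W := by
    intro h
    have := zsf_card h
    omega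
  simp only [ZSF, not_forall, not_not] at hz
  obtain ⟨T, hT, hT0, hTs⟩ := hz
  have h1 := Multiset.card_le_card hT
  obtain ⟨R, rfl⟩ := Multiset.le_iff_exists_add.mp (hT.trans hW)
  rw [Multiset.card_add] at hc
  refine min_false hmin (T₁ := Sof T 0) (T₂ := Sof R 0) ?_ (Sof_ne_left hT0) (Sof_ne_left ?_)
    (real1 hTs) (real1 ?_)
  · rw [← Sof_add, add_zero]
  · rw [← Multiset.card_pos]; omega
  · simpa [hTs] using hs

theorem full_zsf {C F W : Multiset (ZMod (2 * n))} {D : Multiset (ZMod (2 * n) × ZMod (2 * n))}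
    (hmin : IsMinimalProductOne (Sof C (bs D))) (h0 : 0 ∈ SV (C + D.map dl))
    (hD : D ≠ 0) (eC : C = F + W) (hF : Full F) : ZSF W := by
  intro T hT hT0 hTs
  obtain ⟨R, rfl⟩ := Multiset.le_iff_exists_add.mp hT
  refine M1 (T := T) (C := F + R) (D := D) ?_ hT0 hTs hD ?_
  · convert hmin using 2
    rw [eC]; abel
  · rw [add_assoc]
    apply hF.add
    have := SV_even h0
    rw [eC] at this
    simpa [hTs, add_assoc] using this

theorem SV_rep {g v : ZMod (2 * n)} {j k : ℕ} (hj : j ≤ k) (h : v + (k - j) • g = j • g) :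
    v ∈ SV (Multiset.replicate k g) := by
  refine ⟨Multiset.replicate j g, Multiset.replicate (k - j) g, ?_, ?_⟩
  · rw [← Multiset.replicate_add]; congr 1; omega
  · rw [Multiset.sum_replicate, Multiset.sum_replicate, ← h]; abel

theorem even_gen {g e : ZMod (2 * n)} (h2 : (2 * n) • g = 0)
    (hg : ∀ x : ZMod (2 * n), ∃ i : ℕ, i • g = x) (he : Even e) :
    ∃ i < n, e = (2 * i) • g := by
  obtain ⟨y, rfl⟩ := he
  obtain ⟨k, rfl⟩ := hg y
  refine ⟨k % n, Nat.mod_lt _ (Nat.pos_of_ne_zero (NeZero.ne n)), ?_⟩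
  have : k + k = 2 * (k % n) + (k / n) * (2 * n) := by
    have := Nat.mod_add_div k n
    nlinarith
  rw [← add_nsmul, this, add_nsmul, mul_nsmul' g (k / n) (2 * n), h2]; simp

theorem full_rep {g : ZMod (2 * n)} (h2 : (2 * n) • g = 0)
    (hg : ∀ x : ZMod (2 * n), ∃ i : ℕ, i • g = x) : Full (Multiset.replicate (n - 1) g) := by
  intro v hv
  obtain ⟨i, hi, e⟩ := even_gen h2 hg hv
  rw [Multiset.sum_replicate, sub_eq_iff_eq_add] at e
  rcases Nat.eq_zero_or_pos i with rfl | hpos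
  · refine SV_rep (j := n - 1) le_rfl ?_
    rw [e]; simp
  · refine SV_rep (j := i - 1) (by omega) ?_
    rw [e, ← add_nsmul, ← add_nsmul]
    have : 2 * i + (n - 1) + (n - 1 - (i - 1)) = 2 * n + (i - 1) := by omega
    rw [this, add_nsmul, h2, zero_add]

theorem main_k1 (hn : 2 ≤ n) {C : Multiset (ZMod (2 * n))} {d}
    (hmin : IsMinimalProductOne (Sof C (bs {d}))) (h0 : 0 ∈ SV (C + Multiset.map dl {d}))
    (hc : C.card = 3 * n - 2) : ∃ g b : ZMod (2 * n), C = Multiset.replicate (3 * n - 2) g ∧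
      d = (b, b) ∧ (∀ x : ZMod (2 * n), ∃ i : ℕ, i • g = x) ∧ n • g = (n : ZMod (2 * n)) := by
  obtain ⟨U, W, rfl, hW, h1, hz, h2⟩ := phase1 hmin h0 (add_zero {d}).symm
  have h3 := ncard_pos ({dl d} : Multiset (ZMod (2 * n)))
  have h4 := SV_ncard_le (U + Multiset.map dl {d})
  have h5 := zsf_card hz
  rw [Multiset.card_add] at hc
  by_cases hF : Full (U + Multiset.map dl {d})
  swap
  · obtain ⟨h6, h7⟩ := not_full hF
    omega
  have hWc : W.card = 2 * n - 1 := by omega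
  have hUc : U.card = n - 1 := by omega
  obtain ⟨g, hg⟩ := Multiset.exists_mem_of_ne_zero (s := W) (by rw [← Multiset.card_pos]; omega)
  have eW := hz.eq_replicate (by rw [Nat.card_zmod]; omega) hg
  rw [hWc] at eW
  have hi : ∀ i, 0 < i → i < 2 * n → i • g ≠ 0 := by
    intro i hi0 hi1 h
    refine hz (Multiset.replicate i g) ?_ ?_ ?_
    · rw [eW, Multiset.replicate_le_replicate]; omega
    · rw [← Multiset.card_pos]; simpa using hi0
    · rw [Multiset.sum_replicate, h]
  have h2n : (2 * n) • g = 0 := by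
    have := card_nsmul_eq_zero' (G := ZMod (2 * n)) (x := g)
    rwa [Nat.card_zmod] at this
  have hord : addOrderOf g = 2 * n := by
    have ha := addOrderOf_le_of_nsmul_eq_zero (by omega) h2n
    have hb := addOrderOf_pos g
    by_contra hne
    exact hi _ hb (by omega) (addOrderOf_nsmul_eq_zero g)
  have hgen : ∀ x : ZMod (2 * n), ∃ i : ℕ, i • g = x := by
    intro x
    have htop : AddSubgroup.zmultiples g = ⊤ := by
      apply AddSubgroup.eq_top_of_card_eq
      rw [Nat.card_zmultiples, hord, Nat.card_zmod]
    have hx : x ∈ AddSubgroup.zmultiples g := by rw [htop]; trivial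
    rw [← mem_multiples_iff_mem_zmultiples] at hx
    exact hx
  have hFr := full_rep h2n hgen
  have hzW : ZSF (Multiset.replicate n g + U) := by
    refine full_zsf hmin h0 (by simp) ?_ hFr
    rw [← add_assoc, ← Multiset.replicate_add, eW, add_comm]
    congr 2; omega
  have e2 := hzW.eq_replicate (g := g) (by
    rw [Nat.card_zmod, Multiset.card_add, Multiset.card_replicate]; omega) (by
    simp only [Multiset.mem_add, Multiset.mem_replicate]; left; exact ⟨by omega, trivial⟩)
  have eC : U + W = Multiset.replicate (3 * n - 2) g := by
    have : U + W = Multiset.replicate (n - 1) g + (Multiset.replicate n g + U) := by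
      rw [← add_assoc, ← Multiset.replicate_add, eW, add_comm]
      congr 2; omega
    rw [this, e2, ← Multiset.replicate_add, Multiset.card_add, Multiset.card_replicate]
    congr 1; omega
  rw [eC] at hmin h0
  have hng : n • g = (n : ZMod (2 * n)) := by
    rcases two_tor (z := n • g) (by rw [← add_nsmul, ← two_mul, h2n]) with h | h
    · exact absurd h (hi n (by omega) (by omega))
    · exact h
  have hnot : (0 : ZMod (2 * n)) ∉ SV (Multiset.replicate (n - 2) g + Multiset.map dl {d}) := by
    intro h
    refine M1 (T := Multiset.replicate (2 * n) g) (C := Multiset.replicate (n - 2) g) (D := {d})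
      ?_ ?_ ?_ (by simp) h
    · rw [← Multiset.replicate_add]
      convert hmin using 3
      omega
    · rw [← Multiset.card_pos]; simp; omega
    · rw [Multiset.sum_replicate, h2n]
  have hev : Even (dl d - n • g) := by
    have h7 := (SV_even h0).neg
    rw [Multiset.sum_add, Multiset.sum_replicate] at h7
    have e8 : (3 * n - 2) • g = n • g + ((n - 1) • g + (n - 1) • g) := by
      rw [← add_nsmul, ← add_nsmul]; congr 1; omega
    rw [e8] at h7
    obtain ⟨y, hy⟩ := h7
    have hnn : n • g + n • g = 0 := by rw [← add_nsmul, ← two_mul, h2n]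
    refine ⟨y - (n - 1) • g - n • g, ?_⟩
    have hy' : dl d = y + y - (n • g + ((n - 1) • g + (n - 1) • g)) := by
      rw [← hy]; simp
    rw [hy']; abel
  obtain ⟨i, hin, ei⟩ := even_gen h2n hgen hev
  have hd : dl d = n • g := by
    rcases Nat.eq_zero_or_pos i with rfl | hpos
    · simpa [sub_eq_zero] using ei
    · exfalso
      apply hnot
      rw [SV_add]
      refine ⟨dl d, SV_rep (j := i - 1) (by omega) ?_, -dl d, by simp [SV_single], by simp⟩
      rw [sub_eq_iff_eq_add.mp ei, ← add_nsmul, ← add_nsmul]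
      have : 2 * i + n + (n - 2 - (i - 1)) = 2 * n + (i - 1) := by omega
      rw [this, add_nsmul, h2n, zero_add]
  refine ⟨g, d.1, eC, ?_, hgen, hng⟩
  rw [hng, dl] at hd
  have : d.1 = d.2 := by
    have := add_eq_right.mp hd
    exact sub_eq_zero.mp this
  exact Prod.ext rfl this.symm

end Dic6

set_option linter.unusedSectionVars false
section Conv
variable {G : Type*} [Group G]

theorem conv_swap {α τ : G} (h : τ * α = α⁻¹ * τ) (m : ℤ) : τ * α ^ m = α ^ (-m) * τ := by
  have h1 : SemiconjBy τ α α⁻¹ := h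
  have h2 := h1.zpow_right m
  rw [inv_zpow'] at h2
  exact h2

theorem conv_form {n : ℕ} {α τ : G} (hcl : Subgroup.closure {α, τ} = ⊤) (h2 : τ ^ 2 = α ^ n)
    (h3 : τ * α = α⁻¹ * τ) (x : G) : ∃ i : ℤ, x = α ^ i ∨ x = α ^ i * τ := by
  have hx : x ∈ Subgroup.closure {α, τ} := by rw [hcl]; trivial
  have hs := conv_swap h3
  have h2' : τ * τ = α ^ (n : ℤ) := by rw [← sq, h2, zpow_natCast]
  induction hx using Subgroup.closure_induction with
  | mem x hx =>
    rcases hx with rfl | rfl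
    · exact ⟨1, Or.inl (by simp)⟩
    · exact ⟨0, Or.inr (by simp)⟩
  | one => exact ⟨0, Or.inl (by simp)⟩
  | mul x y _ _ hx hy =>
    obtain ⟨i, rfl | rfl⟩ := hx <;> obtain ⟨j, rfl | rfl⟩ := hy
    · exact ⟨i + j, Or.inl (by rw [zpow_add])⟩
    · exact ⟨i + j, Or.inr (by rw [zpow_add, mul_assoc])⟩
    · exact ⟨i - j, Or.inr (by rw [mul_assoc, hs, ← mul_assoc, ← zpow_add, sub_eq_add_neg])⟩
    · refine ⟨i - j + n, Or.inl ?_⟩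
      rw [mul_assoc, ← mul_assoc τ, hs, mul_assoc _ τ, h2', ← zpow_add, ← zpow_add]
      congr 1; ring
  | inv x _ hx =>
    obtain ⟨i, rfl | rfl⟩ := hx
    · exact ⟨-i, Or.inl (by simp)⟩
    · refine ⟨n + i, Or.inr ?_⟩
      rw [inv_eq_iff_mul_eq_one, mul_assoc, ← mul_assoc τ, hs, mul_assoc _ τ, h2', ← zpow_add,
        ← zpow_add]
      convert zpow_zero α using 2; ring

theorem conv_list {α τ : G} (h3 : τ * α = α⁻¹ * τ) (l : List G) (hl : ∀ x ∈ l, x = α ∨ x = τ) :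
    ∃ (x y : ℕ) (z : ℤ), (l : Multiset G) = Multiset.replicate x α + Multiset.replicate y τ ∧
      |z| ≤ x ∧ (y = 0 → z = x) ∧ l.prod = α ^ z * τ ^ y := by
  induction l with
  | nil => exact ⟨0, 0, 0, by simp, by simp, by simp, by simp⟩
  | cons c l ih =>
    obtain ⟨x, y, z, h1, h2, h4, h5⟩ := ih (fun x hx => hl x (by simp [hx]))
    rcases hl c (by simp) with rfl | rfl
    · refine ⟨x + 1, y, z + 1, ?_, ?_, ?_, ?_⟩
      · rw [← Multiset.cons_coe, h1, Multiset.replicate_succ, Multiset.cons_add]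
      · push_cast
        exact (abs_add_le _ _).trans (by simpa using h2)
      · intro hy; rw [h4 hy]; simp
      · rw [List.prod_cons, h5, ← mul_assoc, add_comm, zpow_add, zpow_one]
    · refine ⟨x, y + 1, -z, ?_, by simpa using h2, by simp, ?_⟩
      · rw [← Multiset.cons_coe, h1, Multiset.replicate_succ, Multiset.add_cons]
      · rw [List.prod_cons, h5, ← mul_assoc, conv_swap h3, mul_assoc, pow_succ']

theorem conv_po {α τ : G} (hne : α ≠ τ) (h3 : τ * α = α⁻¹ * τ) {x y : ℕ}
    (h : IsProductOne (Multiset.replicate x α + Multiset.replicate y τ)) :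
    ∃ z : ℤ, |z| ≤ x ∧ (y = 0 → z = x) ∧ α ^ z * τ ^ y = 1 := by
  classical
  obtain ⟨l, hl, hp⟩ := h
  obtain ⟨x', y', z, h1, h2, h4, h5⟩ := conv_list h3 l (by
    intro c hc
    rw [← Multiset.mem_coe, hl] at hc
    simp only [Multiset.mem_add, Multiset.mem_replicate] at hc
    tauto)
  rw [hl] at h1
  have e1 := congrArg (Multiset.count α) h1
  have e2 := congrArg (Multiset.count τ) h1
  simp only [Multiset.count_add, Multiset.count_replicate, if_true, if_neg hne, if_neg hne.symm,
    add_zero, zero_add] at e1 e2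
  subst e1 e2
  exact ⟨z, h2, h4, by rw [← h5, hp]⟩

theorem converse {n : ℕ} (hn : 2 ≤ n) (hG : Nat.card G = 4 * n) {α τ : G}
    (hcl : Subgroup.closure {α, τ} = ⊤) (h1 : α ^ (2 * n) = 1) (h2 : τ ^ 2 = α ^ n)
    (h3 : τ * α = α⁻¹ * τ) :
    IsMinimalProductOne (Multiset.replicate (3 * n - 2) α + Multiset.replicate 2 τ) := by
  have hform := conv_form hcl h2 h3
  have : Finite G := Nat.finite_of_card_ne_zero (by omega)
  have hord : orderOf α = 2 * n := by
    have ha : orderOf α ≤ 2 * n := orderOf_le_of_pow_eq_one (by omega) h1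
    have hb : Nat.card G ≤ Nat.card (Subgroup.zpowers α × Bool) := by
      apply Nat.card_le_card_of_surjective
        (fun p : Subgroup.zpowers α × Bool => if p.2 then (p.1 : G) else p.1 * τ)
      intro x
      obtain ⟨i, rfl | rfl⟩ := hform x
      · exact ⟨(⟨α ^ i, i, rfl⟩, true), by simp⟩
      · exact ⟨(⟨α ^ i, i, rfl⟩, false), by simp⟩
    rw [Nat.card_prod, Nat.card_zpowers, hG] at hb
    have hB : Nat.card Bool = 2 := by simp
    rw [hB] at hb
    omega
  have hτ : ∀ i : ℤ, α ^ i ≠ τ := by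
    intro i hi
    have htop : Subgroup.zpowers α = ⊤ := by
      rw [eq_top_iff]
      intro x _
      obtain ⟨j, rfl | rfl⟩ := hform x
      · exact ⟨j, rfl⟩
      · exact ⟨j + i, by simp only [zpow_add, hi]⟩
    have := Nat.card_zpowers α
    rw [htop, Subgroup.card_top, hG, hord] at this
    omega
  have hne : α ≠ τ := by simpa using hτ 1
  have key : ∀ x1 x2 y1 y2 : ℕ, x1 + x2 = 3 * n - 2 → y1 + y2 = 2 → x1 + y1 ≠ 0 → x2 + y2 ≠ 0 →
      IsProductOne (Multiset.replicate x1 α + Multiset.replicate y1 τ) →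
      IsProductOne (Multiset.replicate x2 α + Multiset.replicate y2 τ) → y1 ≤ y2 → False := by
    intro x1 x2 y1 y2 hx hy hn1 hn2 p1 p2 hle
    obtain ⟨z1, a1, b1, c1⟩ := conv_po hne h3 p1
    obtain ⟨z2, a2, b2, c2⟩ := conv_po hne h3 p2
    have : y1 = 0 ∨ y1 = 1 := by omega
    rcases this with rfl | rfl
    · have hy2 : y2 = 2 := by omega
      subst hy2
      rw [b1 rfl, pow_zero, mul_one, zpow_natCast] at c1
      have hd := orderOf_dvd_of_pow_eq_one c1
      rw [hord] at hd
      have hle := Nat.le_of_dvd (by omega) hd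
      rw [h2, ← zpow_natCast, ← zpow_add] at c2
      have hd2 := orderOf_dvd_iff_zpow_eq_one.mpr c2
      rw [hord] at hd2
      have hb := abs_le.mp a2
      have := Int.le_of_dvd (by omega) hd2
      push_cast at this
      omega
    · apply hτ (-z1)
      rw [pow_one] at c1
      rw [zpow_neg]
      exact inv_eq_of_mul_eq_one_right c1
  refine ⟨?_, ?_, ?_⟩
  · rw [← Multiset.card_pos]; simp
  · refine ⟨List.replicate (2 * n - 1) α ++ [τ] ++ List.replicate (n - 1) α ++ [τ], ?_, ?_⟩
    · simp only [← Multiset.coe_add, Multiset.coe_replicate, Multiset.coe_singleton]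
      have e : (3 * n - 2) = (2 * n - 1) + (n - 1) := by omega
      rw [e, Multiset.replicate_add]
      have e2 : Multiset.replicate 2 τ = {τ} + {τ} := rfl
      rw [e2]; abel
    · simp only [List.prod_append, List.prod_replicate, List.prod_singleton]
      have e := conv_swap h3 ((n - 1 : ℕ) : ℤ)
      rw [zpow_natCast] at e
      rw [mul_assoc (α ^ (2 * n - 1)), e, mul_assoc, mul_assoc, ← sq, h2, ← zpow_natCast α (2 * n - 1),
        ← zpow_natCast α n, ← zpow_add, ← zpow_add]
      have e2 : ((2 * n - 1 : ℕ) : ℤ) + (-((n - 1 : ℕ) : ℤ) + (n : ℤ)) = ((2 * n : ℕ) : ℤ) := by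
        omega
      rw [e2, zpow_natCast, h1]
  · intro T₁ T₂ t1 t2 p1 p2 e
    obtain ⟨P, Q, P', Q', rfl, eP, eQ⟩ := le_add_split (T := T₁) (by
      rw [e]; exact Multiset.le_add_right _ _)
    have hP : P = Multiset.replicate P.card α := Multiset.eq_replicate.mpr ⟨rfl, fun b hb =>
      Multiset.eq_of_mem_replicate (eP ▸ Multiset.mem_add.mpr (Or.inl hb))⟩
    have hP' : P' = Multiset.replicate P'.card α := Multiset.eq_replicate.mpr ⟨rfl, fun b hb =>
      Multiset.eq_of_mem_replicate (eP ▸ Multiset.mem_add.mpr (Or.inr hb))⟩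
    have hQ : Q = Multiset.replicate Q.card τ := Multiset.eq_replicate.mpr ⟨rfl, fun b hb =>
      Multiset.eq_of_mem_replicate (eQ ▸ Multiset.mem_add.mpr (Or.inl hb))⟩
    have hQ' : Q' = Multiset.replicate Q'.card τ := Multiset.eq_replicate.mpr ⟨rfl, fun b hb =>
      Multiset.eq_of_mem_replicate (eQ ▸ Multiset.mem_add.mpr (Or.inr hb))⟩
    have eT : T₂ = P' + Q' := by
      rw [eP, eQ] at e
      have : P + Q + (P' + Q') = P + Q + T₂ := by rw [← e]; abel
      exact (add_left_cancel this).symm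
    subst eT
    have cP := congrArg Multiset.card eP
    have cQ := congrArg Multiset.card eQ
    rw [Multiset.card_replicate, Multiset.card_add] at cP cQ
    have n1 := Multiset.card_pos.mpr t1
    have n2 := Multiset.card_pos.mpr t2
    rw [Multiset.card_add] at n1 n2
    rw [hP, hQ] at p1
    rw [hP', hQ'] at p2
    rcases le_total Q.card Q'.card with h | h
    · exact key _ _ _ _ cP.symm cQ.symm (by omega) (by omega) p1 p2 h
    · exact key _ _ _ _ (by omega) (by omega) (by omega) (by omega) p2 p1 h

end Conv

section Transport

theorem IsProductOne.map {G H : Type*} [Group G] [Group H] (e : G →* H) {S : Multiset G}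
    (h : IsProductOne S) : IsProductOne (S.map e) := by
  obtain ⟨l, rfl, hp⟩ := h
  exact ⟨l.map e, by simp, by rw [← map_list_prod, hp, map_one]⟩

theorem IsMinimalProductOne.map {G H : Type*} [Group G] [Group H] (e : G ≃* H) {S : Multiset G}
    (h : IsMinimalProductOne S) : IsMinimalProductOne (S.map e) := by
  refine ⟨?_, h.2.1.map e.toMonoidHom, ?_⟩
  · simpa using h.1
  · intro T₁ T₂ t1 t2 p1 p2 he
    refine h.2.2 (T₁.map e.symm) (T₂.map e.symm) (by simpa using t1) (by simpa using t2)
      (p1.map e.symm.toMonoidHom) (p2.map e.symm.toMonoidHom) ?_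
    rw [← Multiset.map_add, ← he, Multiset.map_map]
    simp

/-- the conclusion -/
def Concl {G : Type*} [Group G] (n : ℕ) (S : Multiset G) : Prop :=
  ∃ α τ : G, Subgroup.closure {α, τ} = ⊤ ∧ α ^ (2 * n) = 1 ∧ τ ^ 2 = α ^ n ∧
        τ * α = α⁻¹ * τ ∧
        S = Multiset.replicate (3 * n - 2) α + Multiset.replicate 2 τ

theorem Concl.map {G H : Type*} [Group G] [Group H] {n : ℕ} (e : G ≃* H) {S : Multiset G}
    (h : Concl n S) : Concl n (S.map e) := by
  obtain ⟨α, τ, h1, h2, h3, h4, rfl⟩ := h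
  refine ⟨e α, e τ, ?_, ?_, ?_, ?_, ?_⟩
  · have := congrArg (Subgroup.map e.toMonoidHom) h1
    rw [MonoidHom.map_closure, Subgroup.map_top_of_surjective _ e.surjective] at this
    rw [← this]
    congr 1
    simp [Set.image_pair]
  · rw [← map_pow, h2, map_one]
  · rw [← map_pow, h3, map_pow]
  · rw [← map_mul, h4, map_mul, map_inv]
  · simp

theorem Concl.of_map {G H : Type*} [Group G] [Group H] {n : ℕ} (e : G ≃* H) {S : Multiset G}
    (h : Concl n (S.map e)) : Concl n S := by
  have := h.map e.symm
  rw [Multiset.map_map] at this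
  simpa using this

end Transport

set_option linter.unusedSectionVars false
section Dic8
open QuaternionGroup

theorem a_pow_eq {n : ℕ} (g : ZMod (2 * n)) (k : ℕ) :
    (a g : QuaternionGroup n) ^ k = a (k • g) := by
  induction k with
  | zero => rw [pow_zero, zero_nsmul]; rfl
  | succ k ih => rw [pow_succ, ih, a_mul_a, succ_nsmul]

theorem concl_k1 {n : ℕ} {g b : ZMod (2 * n)} (hgen : ∀ x : ZMod (2 * n), ∃ i : ℕ, i • g = x)
    (hng : n • g = (n : ZMod (2 * n))) :
    Concl n (Sof (Multiset.replicate (3 * n - 2) g) (bs {(b, b)})) := by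
  refine ⟨a g, xa b, ?_, ?_, ?_, ?_, ?_⟩
  · have ha : ∀ x : ZMod (2 * n), (a x : QuaternionGroup n) ∈ Subgroup.closure {a g, xa b} := by
      intro x
      obtain ⟨i, rfl⟩ := hgen x
      rw [← a_pow_eq]
      exact pow_mem (Subgroup.subset_closure (by simp)) _
    rw [eq_top_iff]
    rintro (x | x) -
    · exact ha x
    · have h : (xa x : QuaternionGroup n) = xa b * a (x - b) := by
        rw [xa_mul_a]; congr 1; abel
      rw [h]
      exact mul_mem (Subgroup.subset_closure (by simp)) (ha _)
  · rw [a_pow_eq, nsmul_eq_mul, ZMod.natCast_self, zero_mul]; rfl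
  · rw [a_pow_eq, hng, sq, xa_mul_xa]; congr 1; abel
  · rw [show ((a g : QuaternionGroup n))⁻¹ = a (-g) from rfl, xa_mul_a, a_mul_xa]; congr 1; abel
  · simp [Sof, bs, Multiset.map_replicate]

/-- the elements outside the cyclic subgroup -/
def isX {n : ℕ} : QuaternionGroup n → Bool
  | a _ => false
  | xa _ => true

theorem countP_isX {n : ℕ} (C B : Multiset (ZMod (2 * n))) :
    (Sof C B).countP (fun x => isX x = true) = B.card := by
  unfold Sof
  rw [Multiset.countP_add, Multiset.countP_map, Multiset.countP_map]
  simp [isX]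

theorem forward_core {n : ℕ} (hn : 2 ≤ n) {S : Multiset (QuaternionGroup n)}
    (hmin : IsMinimalProductOne S) (hc : S.card = 3 * n) :
    Concl n S ∨ (n = 2 ∧ 4 ≤ S.countP (fun x => isX x = true)) := by
  have : NeZero n := ⟨by omega⟩
  obtain ⟨C, D, rfl, h0, h1⟩ := R3 hmin.2.1
  rw [Sof_card, bs_card] at hc
  rcases Nat.lt_or_ge D.card 2 with hD | hD
  · rcases Nat.lt_or_ge D.card 1 with hD' | hD'
    · have hD0 : D = 0 := by rw [← Multiset.card_eq_zero]; omega
      subst hD0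
      exact (main_k0 hn hmin (h1 rfl) (by simpa using hc)).elim
    · obtain ⟨d, rfl⟩ := Multiset.card_eq_one.mp (show D.card = 1 by omega)
      obtain ⟨g, b, rfl, rfl, h3, h4⟩ := main_k1 hn hmin h0 (by
        rw [Multiset.card_singleton] at hc; omega)
      exact Or.inl (concl_k1 h3 h4)
  · rcases Nat.lt_or_ge n 3 with h | h
    · refine Or.inr ⟨by omega, ?_⟩
      rw [countP_isX, bs_card]; omega
    · exact (main_k2 h hmin h0 hc hD).elim

/-- an automorphism of order three of the quaternion group of order 8, as a function -/
def phiFun : QuaternionGroup 2 → QuaternionGroup 2 := fun x =>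
  if x = a 1 then xa 0 else if x = a 3 then xa 2 else if x = xa 0 then xa 3
  else if x = xa 2 then xa 1 else if x = xa 3 then a 1 else if x = xa 1 then a 3 else x

theorem phiFun_three : ∀ x, phiFun (phiFun (phiFun x)) = x := by decide

theorem phiFun_mul : ∀ x y, phiFun (x * y) = phiFun x * phiFun y := by decide

/-- the automorphism of order three -/
def phi : QuaternionGroup 2 ≃* QuaternionGroup 2 where
  toFun := phiFun
  invFun x := phiFun (phiFun x)
  left_inv := phiFun_three
  right_inv := phiFun_three
  map_mul' := phiFun_mul

/-- the pair `±i` -/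
def pI (x : QuaternionGroup 2) : Bool := decide (x = a 1 ∨ x = a 3)
/-- the pair `±j` -/
def pJ (x : QuaternionGroup 2) : Bool := decide (x = xa 0 ∨ x = xa 2)
/-- the pair `±k` -/
def pK (x : QuaternionGroup 2) : Bool := decide (x = xa 1 ∨ x = xa 3)

/-- counting function with natural number weights -/
def wt (f : QuaternionGroup 2 → Bool) (S : Multiset (QuaternionGroup 2)) : ℕ :=
  (S.map fun x => (f x).toNat).sum

theorem wt_eq (f : QuaternionGroup 2 → Bool) (S : Multiset (QuaternionGroup 2)) :
    S.countP (fun x => f x = true) = wt f S := by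
  unfold wt
  induction S using Multiset.induction with
  | empty => simp
  | cons x S ih =>
    rw [Multiset.countP_cons, ih, Multiset.map_cons, Multiset.sum_cons, add_comm]
    cases f x <;> simp

theorem wt_add (f g h : QuaternionGroup 2 → Bool)
    (H : ∀ x, (h x).toNat = (f x).toNat + (g x).toNat) (S : Multiset (QuaternionGroup 2)) :
    wt h S = wt f S + wt g S := by
  unfold wt
  rw [← Multiset.sum_map_add]
  simp only [H]

theorem wt_map (f : QuaternionGroup 2 → Bool) (S : Multiset (QuaternionGroup 2)) :
    wt f (S.map phi) = wt (fun x => f (phiFun x)) S := by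
  unfold wt
  rw [Multiset.map_map]; rfl

theorem wt_cons (f : QuaternionGroup 2 → Bool) (x) (S : Multiset (QuaternionGroup 2)) :
    wt f (x ::ₘ S) = (f x).toNat + wt f S := by
  unfold wt
  rw [Multiset.map_cons, Multiset.sum_cons]

theorem wt_le (S : Multiset (QuaternionGroup 2)) : wt pI S + wt pJ S + wt pK S ≤ S.card := by
  have H : ∀ x, (pI x).toNat + (pJ x).toNat + (pK x).toNat ≤ 1 := by decide
  induction S using Multiset.induction with
  | empty => simp [wt]
  | cons x S ih =>
    rw [wt_cons, wt_cons, wt_cons, Multiset.card_cons]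
    have := H x
    omega

theorem wt_extract {f : QuaternionGroup 2 → Bool} {S : Multiset (QuaternionGroup 2)}
    (h : 1 ≤ wt f S) : ∃ x T, S = x ::ₘ T ∧ f x = true := by
  rw [← wt_eq] at h
  obtain ⟨x, hx, hp⟩ := Multiset.countP_pos.mp h
  obtain ⟨T, rfl⟩ := Multiset.exists_cons_of_mem hx
  exact ⟨x, T, rfl, hp⟩

theorem excl_I : ∀ x, pI x = true → (pI x).toNat = 1 ∧ (pJ x).toNat = 0 ∧ (pK x).toNat = 0 := by
  decide
theorem excl_J : ∀ x, pJ x = true → (pI x).toNat = 0 ∧ (pJ x).toNat = 1 ∧ (pK x).toNat = 0 := by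
  decide
theorem excl_K : ∀ x, pK x = true → (pI x).toNat = 0 ∧ (pJ x).toNat = 0 ∧ (pK x).toNat = 1 := by
  decide

theorem triple_prod : ∀ x y z, pI x = true → pJ y = true → pK z = true →
    x * (y * z) = 1 ∨ x * (z * y) = 1 := by decide

theorem triple {S : Multiset (QuaternionGroup 2)} (hI : 1 ≤ wt pI S) (hJ : 1 ≤ wt pJ S)
    (hK : 1 ≤ wt pK S) : ∃ P T, S = P + T ∧ P.card = 3 ∧ IsProductOne P ∧
      wt pI S = wt pI T + 1 ∧ wt pJ S = wt pJ T + 1 ∧ wt pK S = wt pK T + 1 := by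
  obtain ⟨x, S, rfl, hx⟩ := wt_extract hI
  have ex := excl_I x hx
  rw [wt_cons] at hJ hK
  obtain ⟨y, S, rfl, hy⟩ := wt_extract (f := pJ) (S := S) (by omega)
  have ey := excl_J y hy
  rw [wt_cons] at hK
  obtain ⟨z, S, rfl, hz⟩ := wt_extract (f := pK) (S := S) (by omega)
  have ez := excl_K z hz
  refine ⟨x ::ₘ y ::ₘ z ::ₘ 0, S, by simp, by simp, ?_, ?_, ?_, ?_⟩
  · rcases triple_prod x y z hx hy hz with h | h
    · exact ⟨[x, y, z], rfl, by simpa using h⟩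
    · refine ⟨[x, z, y], ?_, by simpa using h⟩
      change x ::ₘ z ::ₘ y ::ₘ 0 = _
      rw [Multiset.cons_swap z y]
  all_goals
    simp only [wt_cons]
    omega

theorem forward_two {S : Multiset (QuaternionGroup 2)}
    (hmin : IsMinimalProductOne S) (hc : S.card = 6) : Concl 2 S := by
  rcases forward_core le_rfl hmin hc with h | ⟨-, h1⟩
  · exact h
  rcases forward_core le_rfl (hmin.map phi) (by rw [Multiset.card_map]; exact hc) with h | ⟨-, h2⟩
  · exact h.of_map
  rcases forward_core le_rfl ((hmin.map phi).map phi)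
    (by rw [Multiset.card_map, Multiset.card_map]; exact hc) with h | ⟨-, h3⟩
  · exact h.of_map.of_map
  exfalso
  rw [wt_eq] at h1 h2 h3
  rw [wt_map] at h2 h3
  rw [wt_map] at h3
  rw [wt_add pJ pK _ (by decide)] at h1
  rw [wt_add pI pJ _ (by decide)] at h2
  rw [wt_add pI pK _ (by decide)] at h3
  have h4 := wt_le S
  obtain ⟨P, T, rfl, hP, pP, e1, e2, e3⟩ := triple (S := S) (by omega) (by omega) (by omega)
  obtain ⟨P', T', rfl, hP', pP', f1, f2, f3⟩ := triple (S := T) (by omega) (by omega) (by omega)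
  rw [Multiset.card_add, Multiset.card_add] at hc
  have hT : T' = 0 := by rw [← Multiset.card_eq_zero]; omega
  subst hT
  rw [add_zero] at hmin
  refine min_false hmin rfl ?_ ?_ pP pP'
  · rintro rfl; simp at hP
  · rintro rfl; simp at hP'

theorem forward_all {n : ℕ} (hn : 2 ≤ n) {S : Multiset (QuaternionGroup n)}
    (hmin : IsMinimalProductOne S) (hc : S.card = 3 * n) : Concl n S := by
  rcases forward_core hn hmin hc with h | ⟨rfl, -⟩
  · exact h
  · exact forward_two hmin hc

end Dic8


theorem minimal_product_one_of_maximal_length_dicyclic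
    (n : ℕ) (hn : 2 ≤ n)
    (G : Type*) [Group G] (hG : Nonempty (G ≃* QuaternionGroup n))
    (S : Multiset G) (hcard : Multiset.card S = 3 * n) :
    IsMinimalProductOne S ↔
      ∃ α τ : G, Subgroup.closure {α, τ} = ⊤ ∧ α ^ (2 * n) = 1 ∧ τ ^ 2 = α ^ n ∧
        τ * α = α⁻¹ * τ ∧
        S = Multiset.replicate (3 * n - 2) α + Multiset.replicate 2 τ := by
  obtain ⟨e⟩ := hG
  constructor
  · intro h
    exact Concl.of_map e (forward_all hn (h.map e) (by rw [Multiset.card_map]; exact hcard))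
  · rintro ⟨α, τ, h1, h2, h3, h4, rfl⟩
    have : NeZero n := ⟨by omega⟩
    refine converse hn ?_ h1 h2 h3 h4
    rw [Nat.card_congr e.toEquiv, Nat.card_eq_fintype_card, QuaternionGroup.card]
end

section
/- Let n ≥ 4 be even and let G = ⟨α, τ | α^n = τ^2 = 1_G, τα = α^{-1}τ⟩ be a dihedral group of order 2n. Let S be a minimal product-one sequence over G such that |S| ≥ n and every term of S lies in G \ ⟨α⟩. Then |S| = n, and S has the following form: (a) if n = 4, then S = τ · (ατ) · (α^2τ) · (α^3τ), or S = (α^x τ)^{[2]} · (α^y τ) · (α^{y+2} τ) for some x, y ∈ [0, 3] with x ≡ y + 1 (mod 2); (b) if n ≥ 6, then S = (α^x τ)^{[v]} · (α^{n/2 + x} τ)^{[n/2 - v]} · (α^y τ)^{[w]} · (α^{n/2 + y} τ)^{[n/2 - w]} for some x, y ∈ [0, n-1] with 2x ≢ 2y (mod n) and gcd(x - y, n/2) = 1, and some v, w ∈ [0, n/2] with x - y ≡ v - w (mod 2). -/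
open Finset

/-! ### Subset sums of minimal zero-sum families -/

/-- the set of subset sums of the family `b` restricted to `I` -/
noncomputable def subSums {ι K : Type*} [DecidableEq ι] [DecidableEq K] [AddCommGroup K]
    (b : ι → K) (I : Finset ι) : Finset K :=
  I.powerset.image (fun A => ∑ i ∈ A, b i)

theorem mem_subSums {ι K : Type*} [DecidableEq ι] [DecidableEq K] [AddCommGroup K]
    {b : ι → K} {I : Finset ι} {x : K} :
    x ∈ subSums b I ↔ ∃ A ⊆ I, ∑ i ∈ A, b i = x := by
  simp [subSums]

theorem subSums_mono {ι K : Type*} [DecidableEq ι] [DecidableEq K] [AddCommGroup K]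
    {b : ι → K} {I J : Finset ι} (h : I ⊆ J) : subSums b I ⊆ subSums b J := by
  intro x hx
  obtain ⟨A, hA, rfl⟩ := mem_subSums.1 hx
  exact mem_subSums.2 ⟨A, hA.trans h, rfl⟩

theorem subSums_insert_card {ι K : Type*} [DecidableEq ι] [DecidableEq K] [AddCommGroup K]
    (b : ι → K) (A : Finset ι) (a : ι) (ha : a ∉ A)
    (hfree : ∀ B ⊆ insert a A, ∑ i ∈ B, b i = 0 → B = ∅) :
    (subSums b A).card + 1 ≤ (subSums b (insert a A)).card := by
  by_contra hcon
  have hsub : subSums b A ⊆ subSums b (insert a A) := subSums_mono (subset_insert a A)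
  have heq : subSums b A = subSums b (insert a A) :=
    eq_of_subset_of_card_le hsub (by omega)
  have himg : (subSums b A).image (fun x => x + b a) ⊆ subSums b A := by
    intro x hx
    obtain ⟨y, hy, rfl⟩ := mem_image.1 hx
    obtain ⟨B, hB, rfl⟩ := mem_subSums.1 hy
    rw [heq]
    refine mem_subSums.2 ⟨insert a B, insert_subset_insert a hB, ?_⟩
    rw [sum_insert (fun h => ha (hB h)), add_comm]
  have hcard : ((subSums b A).image (fun x => x + b a)).card = (subSums b A).card :=
    card_image_of_injective _ (add_left_injective (b a))
  have himg2 := eq_of_subset_of_card_le himg hcard.ge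
  have h0 : (0 : K) ∈ (subSums b A).image (fun x => x + b a) := by
    rw [himg2]
    exact mem_subSums.2 ⟨∅, empty_subset _, by simp⟩
  obtain ⟨y, hy, hy0⟩ := mem_image.1 h0
  obtain ⟨B, hB, rfl⟩ := mem_subSums.1 hy
  have := hfree (insert a B) (insert_subset_insert a hB) (by
    rw [sum_insert (fun h => ha (hB h)), add_comm]; exact hy0)
  exact insert_ne_empty _ _ this

theorem subSums_grow {ι K : Type*} [DecidableEq ι] [DecidableEq K] [AddCommGroup K]
    (b : ι → K) (A : Finset ι) (T : Finset ι) (hd : Disjoint A T)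
    (hfree : ∀ B ⊆ A ∪ T, ∑ i ∈ B, b i = 0 → B = ∅) :
    (subSums b A).card + T.card ≤ (subSums b (A ∪ T)).card := by
  induction T using Finset.induction_on with
  | empty => simp
  | insert a T haT ih =>
    rw [disjoint_insert_right] at hd
    have hu : A ∪ insert a T = insert a (A ∪ T) := by ext; simp
    rw [hu] at hfree ⊢
    have h1 := ih hd.2 (fun B hB => hfree B (hB.trans (subset_insert _ _)))
    have h2 := subSums_insert_card b (A ∪ T) a (by simp [hd.1, haT]) hfree
    rw [card_insert_of_notMem haT]
    omega

theorem card_le_subSums {ι K : Type*} [DecidableEq ι] [DecidableEq K] [AddCommGroup K]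
    (b : ι → K) (I : Finset ι)
    (hmin : ∀ B ⊆ I, ∑ i ∈ B, b i = 0 → B = ∅ ∨ B = I) :
    I.card ≤ (subSums b I).card := by
  rcases I.eq_empty_or_nonempty with rfl | ⟨t, ht⟩
  · simp
  have h := subSums_grow b ∅ (I.erase t) (by simp) (by
    intro B hB h0
    rw [empty_union] at hB
    rcases hmin B (hB.trans (erase_subset _ _)) h0 with h | h
    · exact h
    · subst h; exact absurd (hB ht) (notMem_erase _ _))
  rw [empty_union, card_erase_of_mem ht] at h
  have h1 : (subSums b (∅ : Finset ι)).card = 1 := by simp [subSums]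
  have h2 := card_le_card (subSums_mono (b := b) (erase_subset t I))
  have := card_pos.2 ⟨t, ht⟩
  omega

theorem card_lt_subSums {ι K : Type*} [DecidableEq ι] [DecidableEq K] [AddCommGroup K]
    (b : ι → K) (I : Finset ι)
    (hmin : ∀ B ⊆ I, ∑ i ∈ B, b i = 0 → B = ∅ ∨ B = I) (i j : ι) (hi : i ∈ I) (hj : j ∈ I)
    (hij : b i ≠ b j) :
    I.card + 1 ≤ (subSums b I).card := by
  have hne : i ≠ j := fun h => hij (by rw [h])
  have hpair : ({i, j} : Finset ι) ⊆ I := by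
    intro x hx; simp at hx; rcases hx with rfl | rfl <;> assumption
  have hbi : b i ≠ 0 := by
    intro h
    rcases hmin {i} (by simpa using hi) (by simpa using h) with h | h
    · simp at h
    · rw [← h] at hj; simp at hj; exact hne hj.symm
  have hbj : b j ≠ 0 := by
    intro h
    rcases hmin {j} (by simpa using hj) (by simpa using h) with h | h
    · simp at h
    · rw [← h] at hi; simp at hi; exact hne hi
  by_cases hI : I = {i, j}
  · have h3 : ({0, b i, b j} : Finset K) ⊆ subSums b I := by
      intro x hx
      simp at hx
      rcases hx with rfl | rfl | rfl
      · exact mem_subSums.2 ⟨∅, by simp, by simp⟩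
      · exact mem_subSums.2 ⟨{i}, by simpa using hi, by simp⟩
      · exact mem_subSums.2 ⟨{j}, by simpa using hj, by simp⟩
    have hc : ({0, b i, b j} : Finset K).card = 3 :=
      card_eq_three.2 ⟨0, b i, b j, hbi.symm, hbj.symm, hij, rfl⟩
    have hc2 : I.card = 2 := by rw [hI, card_pair hne]
    have := card_le_card h3
    omega
  · obtain ⟨t, ht, htn⟩ : ∃ t ∈ I, t ∉ ({i, j} : Finset ι) := by
      by_contra hcon
      push Not at hcon
      exact hI (Subset.antisymm hcon hpair)
    have hfree : ∀ B ⊆ I.erase t, ∑ i ∈ B, b i = 0 → B = ∅ := by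
      intro B hB h0
      rcases hmin B (hB.trans (erase_subset _ _)) h0 with h | h
      · exact h
      · subst h; exact absurd (hB ht) (notMem_erase _ _)
    have hsub : ({i, j} : Finset ι) ⊆ I.erase t := by
      intro x hx
      refine mem_erase.2 ⟨fun h => htn (h ▸ hx), hpair hx⟩
    have hun : {i, j} ∪ (I.erase t \ {i, j}) = I.erase t := union_sdiff_of_subset hsub
    have h := subSums_grow b {i, j} (I.erase t \ {i, j}) disjoint_sdiff (by
      rw [hun]; exact hfree)
    rw [hun, card_sdiff_of_subset hsub, card_pair hne, card_erase_of_mem ht] at h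
    have hsum : b i + b j ≠ 0 := by
      intro h0
      have := hfree {i, j} hsub (by rw [sum_pair hne]; exact h0)
      simp at this
    have h4 : ({0, b i, b j, b i + b j} : Finset K) ⊆ subSums b {i, j} := by
      intro x hx
      simp only [mem_insert, mem_singleton] at hx
      rcases hx with rfl | rfl | rfl | rfl
      · exact mem_subSums.2 ⟨∅, by simp, by simp⟩
      · exact mem_subSums.2 ⟨{i}, by simp, by simp⟩
      · exact mem_subSums.2 ⟨{j}, by simp, by simp⟩
      · exact mem_subSums.2 ⟨{i, j}, by simp, sum_pair hne⟩
    have hc : ({0, b i, b j, b i + b j} : Finset K).card = 4 := by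
      rw [card_insert_of_notMem, card_insert_of_notMem, card_pair]
      · simpa using hbi
      · simp [hij, hbj]
      · simp [hbi.symm, hbj.symm, hsum.symm]
    have h5 := card_le_card h4
    have h6 := card_le_card (subSums_mono (b := b) (erase_subset t I))
    have h7 := card_le_card (hsub)
    rw [card_pair hne, card_erase_of_mem ht] at h7
    omega

/-! ### Arrangements -/

/-- `S` is arranged as the positive terms `p` and the negative terms `q`. -/
def Arr {ι R : Type*} [Fintype ι] [AddCommGroup R] (S : Multiset R) (p q : ι → R) : Prop :=
  (∑ i, (({p i} : Multiset R) + {q i})) = S ∧ ∑ i, (p i - q i) = 0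

/-- the standing assumptions of the combinatorial part -/
structure Setup (m : ℕ) (ι R : Type*) [Fintype ι] [AddCommGroup R] (S : Multiset R)
    (f : R →+ ZMod m) (e : R) : Prop where
  ker : ∀ x, f x = 0 → x = 0 ∨ x = e
  fe : f e = 0
  ee : e + e = 0
  hm : 2 ≤ m
  hk : m ≤ Fintype.card ι
  h3 : 3 ≤ Fintype.card ι
  hmin : ∀ p q : ι → R, Arr S p q → ∀ A : Finset ι, ∑ i ∈ A, (p i - q i) = 0 →
    A = ∅ ∨ A = univ

set_option linter.unusedSectionVars false

section arr
variable {m : ℕ} {ι R : Type*} [Fintype ι] [DecidableEq ι] [AddCommGroup R] {S : Multiset R}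
  {f : R →+ ZMod m} {e : R} {p q : ι → R}

theorem Arr.symm (h : Arr S p q) : Arr S q p := by
  refine ⟨?_, ?_⟩
  · rw [← h.1]; exact sum_congr rfl (fun i _ => add_comm _ _)
  · have := h.2
    rw [← neg_eq_zero, ← sum_neg_distrib]
    simpa using this

theorem Arr.swap (h : Arr S p q) (i j : ι) : Arr S p (q ∘ Equiv.swap i j) := by
  refine ⟨?_, ?_⟩
  · rw [← h.1, sum_add_distrib, sum_add_distrib]
    congr 1
    exact Equiv.sum_comp (Equiv.swap i j) (fun i => ({q i} : Multiset R))
  · have := h.2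
    rw [sum_sub_distrib] at this ⊢
    rw [← this]
    congr 1
    exact Equiv.sum_comp (Equiv.swap i j) q

theorem Setup.sum_ker (hs : Setup m ι R S f e) (A : Finset ι) (d : ι → R)
    (hA : ∑ i ∈ A, f (d i) = 0) : ∑ i ∈ A, d i = 0 ∨ ∑ i ∈ A, d i = e := by
  apply hs.ker
  rw [map_sum]; exact hA

theorem Setup.flip (hs : Setup m ι R S f e) (h : Arr S p q) (A : Finset ι)
    (hA : ∑ i ∈ A, f (p i - q i) = 0) :
    Arr S (fun i => if i ∈ A then q i else p i) (fun i => if i ∈ A then p i else q i) := by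
  refine ⟨?_, ?_⟩
  · rw [← h.1]
    refine sum_congr rfl (fun i _ => ?_)
    by_cases hi : i ∈ A <;> simp [hi, add_comm]
  · have h2 := h.2
    have : ∀ i, ((if i ∈ A then q i else p i) - (if i ∈ A then p i else q i)) =
        (p i - q i) - (if i ∈ A then (p i - q i) + (p i - q i) else 0) := by
      intro i; by_cases hi : i ∈ A <;> simp [hi]
    rw [sum_congr rfl (fun i _ => this i), sum_sub_distrib, h2, sum_ite_mem, univ_inter,
      sum_add_distrib]
    rcases hs.sum_ker A _ hA with h | h <;> simp [h, hs.ee]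

theorem Setup.two_zeros (hs : Setup m ι R S f e) (h : Arr S p q) (i j : ι) (hij : i ≠ j)
    (hi : f (p i - q i) = 0) (hj : f (p j - q j) = 0) : False := by
  have hsing : ∀ i, f (p i - q i) = 0 → p i - q i = e := by
    intro i hi
    rcases hs.ker _ hi with h0 | h0
    · rcases hs.hmin p q h {i} (by simpa using h0) with h1 | h1
      · simp at h1
      · have := congrArg Finset.card h1
        have h3 := hs.h3
        simp [card_univ] at this
        omega
    · exact h0
  rcases hs.hmin p q h {i, j} (by rw [sum_pair hij, hsing i hi, hsing j hj, hs.ee]) with h1 | h1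
  · simp at h1
  · have := congrArg Finset.card h1
    have h3 := hs.h3
    rw [card_pair hij, card_univ] at this
    omega

theorem Setup.sing_ne (hs : Setup m ι R S f e) (h : Arr S p q) (i j : ι) : p i ≠ q j := by
  intro h0
  rcases hs.hmin _ _ (h.swap i j) {i} (by simp [h0]) with h1 | h1
  · simp at h1
  · have := congrArg Finset.card h1
    have h3 := hs.h3
    simp [card_univ] at this
    omega

theorem Setup.zero_once_q (hs : Setup m ι R S f e) (h : Arr S p q) (i₀ i : ι) (hi : i ≠ i₀)
    (h0 : f (p i₀ - q i₀) = 0) : f (q i) ≠ f (p i₀) := by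
  intro hq
  have h1 : f (p i₀ - q i) = 0 := by rw [map_sub, hq, sub_self]
  have e1 : p i₀ - q i = e := by
    rcases hs.ker _ h1 with h2 | h2
    · exact absurd (sub_eq_zero.1 h2) (hs.sing_ne h _ _)
    · exact h2
  have e2 : p i₀ - q i₀ = e := by
    rcases hs.ker _ h0 with h2 | h2
    · exact absurd (sub_eq_zero.1 h2) (hs.sing_ne h _ _)
    · exact h2
  have e3 : q i₀ = q i := by
    have := e1.trans e2.symm
    exact (sub_right_injective this).symm
  have hfl := hs.flip h {i₀} (by simpa using h0)
  apply hs.sing_ne hfl i₀ i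
  simp [hi, e3]

theorem Setup.zero_once_p (hs : Setup m ι R S f e) (h : Arr S p q) (i₀ i : ι) (hi : i ≠ i₀)
    (h0 : f (p i₀ - q i₀) = 0) : f (p i) ≠ f (p i₀) := by
  have h1 : f (q i₀ - p i₀) = 0 := by rw [← neg_sub, map_neg, h0, neg_zero]
  have := hs.zero_once_q h.symm i₀ i hi h1
  have h2 : f (p i₀) = f (q i₀) := by rwa [map_sub, sub_eq_zero] at h0
  rwa [h2]

/-- One value occurring in `p` and in `q` modulo `m` occurs once in each. -/
theorem Setup.once_p (hs : Setup m ι R S f e) (h : Arr S p q) (i j i' : ι) (hi : i' ≠ i)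
    (h0 : f (p i) = f (q j)) : f (p i') ≠ f (p i) := by
  apply hs.zero_once_p (h.swap i j) i i' hi
  simp [h0]

theorem Setup.once_q (hs : Setup m ι R S f e) (h : Arr S p q) (i j j' : ι) (hj : j' ≠ j)
    (h0 : f (p i) = f (q j)) : f (q j') ≠ f (q j) :=
  hs.once_p h.symm j i j' hj h0.symm

theorem Setup.cross (hs : Setup m ι R S f e) (h : Arr S p q) (I : Finset ι)
    (hI : ∑ i ∈ I, f (p i - q i) = 0) (hI0 : I ≠ ∅) (hI1 : I ≠ univ)
    (A B : Finset ι) (hA : A ⊆ I) (hB : Disjoint B I)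
    (hAB : ∑ i ∈ A, f (p i - q i) = ∑ i ∈ B, f (p i - q i)) : B = ∅ ∨ B = Iᶜ := by
  have hIe : ∑ i ∈ I, (p i - q i) = e := by
    rcases hs.sum_ker I _ hI with h1 | h1
    · rcases hs.hmin p q h I h1 with h2 | h2
      · exact absurd h2 hI0
      · exact absurd h2 hI1
    · exact h1
  have hdis : Disjoint A B := (hB.mono_right hA).symm
  have key : ∀ A' ⊆ I, A' ∪ B = ∅ ∨ A' ∪ B = univ → B = ∅ ∨ B = Iᶜ := by
    intro A' hA' h2
    rcases h2 with h2 | h2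
    · left; exact (union_eq_empty.1 h2).2
    · right
      apply Subset.antisymm
      · intro x hx; exact mem_compl.2 (fun hx' => (disjoint_left.1 hB) hx hx')
      · intro x hx
        have : x ∈ A' ∪ B := by rw [h2]; exact mem_univ _
        rcases mem_union.1 this with h3 | h3
        · exact absurd (hA' h3) (mem_compl.1 hx)
        · exact h3
  have h1 : f (∑ i ∈ A, (p i - q i) - ∑ i ∈ B, (p i - q i)) = 0 := by
    rw [map_sub, map_sum, map_sum, hAB, sub_self]
  rcases hs.ker _ h1 with h2 | h2
  · have hfl := hs.flip h I hI
    apply key A hA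
    apply hs.hmin _ _ hfl
    rw [sum_union hdis]
    have e1 : ∑ i ∈ A, ((if i ∈ I then q i else p i) - (if i ∈ I then p i else q i)) =
        - ∑ i ∈ A, (p i - q i) := by
      rw [← sum_neg_distrib]
      refine sum_congr rfl (fun i hi => ?_)
      simp [hA hi]
    have e2 : ∑ i ∈ B, ((if i ∈ I then q i else p i) - (if i ∈ I then p i else q i)) =
        ∑ i ∈ B, (p i - q i) := by
      refine sum_congr rfl (fun i hi => ?_)
      simp [disjoint_left.1 hB hi]
    rw [e1, e2, ← sub_eq_zero.1 h2, neg_add_cancel]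
  · apply key (I \ A) sdiff_subset
    apply hs.hmin _ _ h
    rw [sum_union (hB.mono_right sdiff_subset).symm]
    have e1 := sum_sdiff (f := fun i => p i - q i) hA
    rw [hIe] at e1
    have e2 : ∑ i ∈ I \ A, (p i - q i) = e - ∑ i ∈ A, (p i - q i) := eq_sub_of_add_eq e1
    rw [e2, ← h2]; abel

theorem arith_aux (h j m k : ℕ) (hh : 1 ≤ h) (hj : 1 ≤ j) (hk : k = h + j) (hmk : m ≤ k)
    (hle : h * j ≤ m) : h = 1 ∨ j = 1 ∨ (h = 2 ∧ j = 2 ∧ m = 4) := by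
  by_contra hcon
  push Not at hcon
  obtain ⟨a, rfl⟩ : ∃ a, h = a + 2 := ⟨h - 2, by omega⟩
  obtain ⟨b, rfl⟩ : ∃ b, j = b + 2 := ⟨j - 2, by omega⟩
  have : (a + 2) * (b + 2) = a * b + 2 * a + 2 * b + 4 := by ring
  have h0 : a = 0 := by nlinarith [Nat.zero_le (a * b)]
  have h1 : b = 0 := by nlinarith [Nat.zero_le (a * b)]
  subst h0; subst h1
  omega

/-- The outcome when one block is constant. -/
theorem Setup.const_block [NeZero m] (hs : Setup m ι R S f e) (h : Arr S p q) (I : Finset ι)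
    (hI : ∑ i ∈ I, f (p i - q i) = 0) (hI0 : I ≠ ∅) (hI1 : I ≠ univ)
    (hminI : ∀ B ⊆ I, ∑ i ∈ B, f (p i - q i) = 0 → B = ∅ ∨ B = I)
    (g : ZMod m) (hg : ∀ i ∈ I, f (p i - q i) = g) :
    (∃ i, f (p i - q i) = 0) ∨
    (m = 4 ∧ ∃ i₁ i₂, i₁ ≠ i₂ ∧ f (p i₁ - q i₁) = f (p i₂ - q i₂) ∧
      f (p i₁ - q i₁) + f (p i₁ - q i₁) = 0 ∧ f (p i₁ - q i₁) ≠ 0 ∧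
      ∀ j, j ≠ i₁ → j ≠ i₂ → f (p j - q j) ≠ 0 ∧ f (p j - q j) ≠ f (p i₁ - q i₁)) := by
  have hsumI : ∀ B ⊆ I, ∑ i ∈ B, f (p i - q i) = B.card • g := by
    intro B hB
    rw [sum_congr rfl (fun i hi => hg i (hB hi)), sum_const]
  have hIc : I.card • g = 0 := by rw [← hsumI I (Subset.refl _)]; exact hI
  have hIpos : 0 < I.card := card_pos.2 (nonempty_iff_ne_empty.2 hI0)
  have hord : addOrderOf g = I.card := by
    apply Nat.le_antisymm
    · exact addOrderOf_le_of_nsmul_eq_zero hIpos hIc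
    · by_contra hlt
      push Not at hlt
      obtain ⟨B, hB, hBc⟩ := exists_subset_card_eq hlt.le
      have := hminI B hB (by rw [hsumI B hB, hBc, addOrderOf_nsmul_eq_zero])
      rcases this with h1 | h1
      · rw [h1, card_empty] at hBc
        exact absurd (isOfFinAddOrder_of_finite g).addOrderOf_pos (by omega)
      · rw [h1] at hBc; omega
  have hJmin : ∀ B ⊆ Iᶜ, ∑ i ∈ B, (QuotientAddGroup.mk (f (p i - q i)) :
      ZMod m ⧸ AddSubgroup.zmultiples g) = 0 → B = ∅ ∨ B = Iᶜ := by
    intro B hB h0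
    have h1 : (QuotientAddGroup.mk (∑ i ∈ B, f (p i - q i)) :
      ZMod m ⧸ AddSubgroup.zmultiples g) = 0 := by
      rw [← h0]
      exact map_sum (QuotientAddGroup.mk' (AddSubgroup.zmultiples g)) _ _
    rw [QuotientAddGroup.eq_zero_iff, mem_zmultiples_iff_mem_range_addOrderOf] at h1
    obtain ⟨t, ht, ht2⟩ := mem_image.1 h1
    rw [mem_range, hord] at ht
    obtain ⟨A, hA, hAc⟩ := exists_subset_card_eq ht.le
    refine hs.cross h I hI hI0 hI1 A B hA ?_ ?_
    · exact disjoint_left.2 (fun x hx hx' => mem_compl.1 (hB hx) hx')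
    · rw [hsumI A hA, hAc]; exact ht2
  classical
  have hle := card_le_subSums _ _ hJmin
  have hle2 := hle.trans (card_le_univ _)
  rw [← Nat.card_eq_fintype_card] at hle2
  have hlag := AddSubgroup.card_eq_card_quotient_mul_card_addSubgroup
    (AddSubgroup.zmultiples g)
  rw [Nat.card_zmultiples, hord, Nat.card_zmod] at hlag
  have hmul : I.card * (Iᶜ).card ≤ m := by
    rw [hlag, mul_comm]
    exact Nat.mul_le_mul_right _ hle2
  have hcc := card_add_card_compl I
  have hIc0 : (Iᶜ).Nonempty := by
    rw [nonempty_iff_ne_empty]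
    intro h1
    exact hI1 (by simpa using h1)
  have hIcsum : ∑ i ∈ Iᶜ, f (p i - q i) = 0 := by
    have h1 := sum_add_sum_compl I (fun i => f (p i - q i))
    rw [hI, zero_add, ← map_sum f _ univ, h.2, map_zero] at h1
    exact h1
  rcases arith_aux I.card (Iᶜ).card m (Fintype.card ι) hIpos (card_pos.2 hIc0) hcc.symm hs.hk hmul
    with h1 | h1 | ⟨h1, h2, h3⟩
  · left
    obtain ⟨i, rfl⟩ := card_eq_one.1 h1
    exact ⟨i, by simpa using hI⟩
  · left
    obtain ⟨i, hi⟩ := card_eq_one.1 h1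
    rw [hi] at hIcsum
    exact ⟨i, by simpa using hIcsum⟩
  · right
    refine ⟨h3, ?_⟩
    obtain ⟨i₁, i₂, hne, rfl⟩ := card_eq_two.1 h1
    have hg1 := hg i₁ (by simp)
    have hg2 := hg i₂ (by simp)
    refine ⟨i₁, i₂, hne, hg1.trans hg2.symm, ?_, ?_, ?_⟩
    · rw [sum_pair hne, hg1, hg2] at hI
      rw [hg1]; exact hI
    · intro h0
      rcases hminI {i₁} (by simp) (by simpa using h0) with h4 | h4
      · simp at h4
      · have := congrArg Finset.card h4
        rw [card_pair hne] at this
        simp at this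
    · intro j hj1 hj2
      have hjm : ({j} : Finset ι) ⊆ {i₁, i₂}ᶜ := by simp [hj1, hj2]
      have hq : f (p j - q j) ∈ AddSubgroup.zmultiples g → False := by
        intro hz
        rcases hJmin {j} hjm (by
          rw [sum_singleton, QuotientAddGroup.eq_zero_iff]; exact hz) with h4 | h4
        · simp at h4
        · rw [← h4] at h2; simp at h2
      refine ⟨fun h0 => hq ?_, fun h0 => hq ?_⟩
      · rw [h0]; exact zero_mem _
      · rw [h0, hg1]; exact AddSubgroup.mem_zmultiples g

/-- Every arrangement is of one of three types. -/
theorem Setup.trichotomy [NeZero m] (hs : Setup m ι R S f e) (h : Arr S p q) :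
    (m = Fintype.card ι ∧ (∀ i j, f (p i - q i) = f (p j - q j)) ∧
      ∀ A : Finset ι, ∑ i ∈ A, f (p i - q i) = 0 → A = ∅ ∨ A = univ) ∨
    (∃ i, f (p i - q i) = 0) ∨
    (m = 4 ∧ ∃ i₁ i₂, i₁ ≠ i₂ ∧ f (p i₁ - q i₁) = f (p i₂ - q i₂) ∧
      f (p i₁ - q i₁) + f (p i₁ - q i₁) = 0 ∧ f (p i₁ - q i₁) ≠ 0 ∧
      ∀ j, j ≠ i₁ → j ≠ i₂ → f (p j - q j) ≠ 0 ∧ f (p j - q j) ≠ f (p i₁ - q i₁)) := by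
  by_cases hmin : ∀ A : Finset ι, ∑ i ∈ A, f (p i - q i) = 0 → A = ∅ ∨ A = univ
  · left
    have hmin' : ∀ A ⊆ (univ : Finset ι), ∑ i ∈ A, f (p i - q i) = 0 → A = ∅ ∨ A = univ :=
      fun A _ => hmin A
    have h1 := (card_le_subSums _ _ hmin').trans (card_le_univ _)
    rw [card_univ, ZMod.card] at h1
    refine ⟨le_antisymm hs.hk h1, ?_, hmin⟩
    intro i j
    by_contra hij
    have h2 := (card_lt_subSums _ _ hmin' i j (mem_univ _) (mem_univ _) hij).trans
      (card_le_univ _)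
    rw [card_univ, ZMod.card] at h2
    have := hs.hk
    omega
  · right
    push Not at hmin
    obtain ⟨I, hI, hI0', hI1⟩ := hmin
    have hI0 : I ≠ ∅ := by
      rcases hI0' with ⟨x, hx⟩
      exact ne_empty_of_mem hx
    have hIcsum : ∑ i ∈ Iᶜ, f (p i - q i) = 0 := by
      have h1 := sum_add_sum_compl I (fun i => f (p i - q i))
      rw [hI, zero_add, ← map_sum f _ univ, h.2, map_zero] at h1
      exact h1
    have hIc0 : Iᶜ ≠ ∅ := fun h1 => hI1 (by simpa using h1)
    have hIc1 : Iᶜ ≠ univ := fun h1 => hI0 (by simpa using h1)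
    have hm1 : ∀ B ⊆ Iᶜ, ∑ i ∈ B, f (p i - q i) = 0 → B = ∅ ∨ B = Iᶜ := by
      intro B hB h0
      exact hs.cross h I hI hI0 hI1 ∅ B (empty_subset _)
        (disjoint_left.2 (fun x hx hx' => mem_compl.1 (hB hx) hx')) (by rw [h0, sum_empty])
    have hm2 : ∀ B ⊆ I, ∑ i ∈ B, f (p i - q i) = 0 → B = ∅ ∨ B = I := by
      intro B hB h0
      have := hs.cross h Iᶜ hIcsum hIc0 hIc1 ∅ B (empty_subset _)
        (disjoint_left.2 (fun x hx hx' => mem_compl.1 hx' (hB hx))) (by rw [h0, sum_empty])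
      rwa [compl_compl] at this
    by_cases c1 : ∃ i ∈ I, ∃ j ∈ I, f (p i - q i) ≠ f (p j - q j)
    · by_cases c2 : ∃ i ∈ Iᶜ, ∃ j ∈ Iᶜ, f (p i - q i) ≠ f (p j - q j)
      · exfalso
        obtain ⟨i, hi, j, hj, hij⟩ := c1
        obtain ⟨i', hi', j', hj', hij'⟩ := c2
        have l1 := card_lt_subSums _ I hm2 i j hi hj hij
        have l2 := card_lt_subSums _ Iᶜ hm1 i' j' hi' hj' hij'
        have hint : subSums (fun i => f (p i - q i)) I ∩ subSums (fun i => f (p i - q i)) Iᶜ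
            ⊆ {0} := by
          intro x hx
          obtain ⟨hx1, hx2⟩ := mem_inter.1 hx
          obtain ⟨A, hA, hAx⟩ := mem_subSums.1 hx1
          obtain ⟨B, hB, hBx⟩ := mem_subSums.1 hx2
          have := hs.cross h I hI hI0 hI1 A B hA
            (disjoint_left.2 (fun x hx hx' => mem_compl.1 (hB hx) hx')) (hAx.trans hBx.symm)
          rw [mem_singleton, ← hBx]
          rcases this with rfl | rfl
          · simp
          · exact hIcsum
        have l3 := card_le_card hint
        have l4 := card_union_add_card_inter (subSums (fun i => f (p i - q i)) I)
          (subSums (fun i => f (p i - q i)) Iᶜ)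
        have l5 := card_le_univ (subSums (fun i => f (p i - q i)) I ∪
          subSums (fun i => f (p i - q i)) Iᶜ)
        rw [ZMod.card] at l5
        rw [card_singleton] at l3
        have l6 := card_add_card_compl I
        have := hs.hk
        omega
      · push Not at c2
        obtain ⟨j, hj⟩ := nonempty_iff_ne_empty.2 hIc0
        exact hs.const_block h Iᶜ hIcsum hIc0 hIc1 hm1 _ (fun i hi => c2 i hi j hj)
    · push Not at c1
      obtain ⟨j, hj⟩ := nonempty_iff_ne_empty.2 hI0
      exact hs.const_block h I hI hI0 hI1 hm2 _ (fun i hi => c1 i hi j hj)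

theorem Setup.no_B [NeZero m] (hs : Setup m ι R S f e) (h : Arr S p q) (hm4 : m = 4)
    (i₁ i₂ : ι) (hne : i₁ ≠ i₂) (hb : f (p i₁ - q i₁) = f (p i₂ - q i₂))
    (h2g : f (p i₁ - q i₁) + f (p i₁ - q i₁) = 0) (hg0 : f (p i₁ - q i₁) ≠ 0)
    (hj : ∀ j, j ≠ i₁ → j ≠ i₂ → f (p j - q j) ≠ 0 ∧ f (p j - q j) ≠ f (p i₁ - q i₁)) :
    False := by
  subst hm4
  have hsw := h.swap i₁ i₂
  have hother : ∀ j, j ≠ i₁ → j ≠ i₂ → (q ∘ Equiv.swap i₁ i₂) j = q j := by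
    intro j h1 h2; simp [Equiv.swap_apply_of_ne_of_ne h1 h2]
  have hq1 : (q ∘ Equiv.swap i₁ i₂) i₁ = q i₂ := by simp
  have hq2 : (q ∘ Equiv.swap i₁ i₂) i₂ = q i₁ := by simp
  have hsum : f (p i₁ - q i₂) + f (p i₂ - q i₁) = 0 := by
    rw [← h2g]
    nth_rewrite 2 [hb]
    simp only [map_sub]; abel
  obtain ⟨j, hj1, hj2⟩ : ∃ j, j ≠ i₁ ∧ j ≠ i₂ := by
    by_contra hcon
    push Not at hcon
    have hsub : (univ : Finset ι) ⊆ {i₁, i₂} := by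
      intro x _
      by_cases hx : x = i₁
      · simp [hx]
      · simp [hcon x hx]
    have := card_le_card hsub
    rw [card_pair hne, card_univ] at this
    have := hs.h3
    omega
  have dec1 : ∀ a b : ZMod 4, a + a = 0 → a ≠ 0 → b + b = 0 → b ≠ 0 → a = b := by decide
  have dec2 : ∀ x g u v : ZMod 4, g + g = 0 → g ≠ 0 → v - u ≠ 0 → v - u ≠ g →
      u = x ∨ u = x - g ∨ v = x ∨ v = x - g := by decide
  have hxg : f (p i₁ - q i₂) = f (p i₁ - q i₁) := by
    rcases hs.trichotomy hsw with ⟨_, hconst, hmin⟩ | ⟨i, hi⟩ | ⟨_, a, b, hab, hab1, ha2, ha0, hoth⟩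
    · exfalso
      rcases hmin {i₁, i₂} (by rw [sum_pair hne, hq1, hq2]; exact hsum) with h1 | h1
      · simp at h1
      · have : j ∈ ({i₁, i₂} : Finset ι) := by rw [h1]; exact mem_univ _
        simp [hj1, hj2] at this
    · exfalso
      by_cases hi1 : i = i₁
      · subst hi1
        rw [hq1] at hi
        refine hs.two_zeros hsw i i₂ hne (by rw [hq1]; exact hi) ?_
        rw [hq2]; rw [hi, zero_add] at hsum; exact hsum
      · by_cases hi2 : i = i₂
        · subst hi2
          rw [hq2] at hi
          refine hs.two_zeros hsw i₁ i hne ?_ (by rw [hq2]; exact hi)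
          rw [hq1]; rw [hi, add_zero] at hsum; exact hsum
        · rw [hother i hi1 hi2] at hi
          exact (hj i hi1 hi2).1 hi
    · have hga := dec1 _ _ ha2 ha0 h2g hg0
      have hin : ∀ c, f (p c - (q ∘ Equiv.swap i₁ i₂) c) = f (p i₁ - q i₁) →
          c = i₁ ∨ c = i₂ := by
        intro c hc
        by_contra hcon
        push Not at hcon
        rw [hother c hcon.1 hcon.2] at hc
        exact (hj c hcon.1 hcon.2).2 hc
      have hgb : f (p b - (q ∘ Equiv.swap i₁ i₂) b) = f (p i₁ - q i₁) := by
        rw [← hab1]; exact hga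
      rcases hin a hga with rfl | rfl
      · rw [hq1] at hga; exact hga
      · rcases hin b hgb with rfl | rfl
        · rw [hq1] at hgb; exact hgb
        · exact absurd rfl hab
  have hqq : f (q i₂) = f (q i₁) := by
    simp only [map_sub] at hxg
    exact sub_right_injective hxg
  have hpp : f (p i₂) = f (p i₁) := by
    simp only [map_sub] at hb
    rw [hqq] at hb
    exact (sub_left_injective hb).symm
  have hfl := hs.flip h {i₁, i₂} (by
    rw [sum_pair hne, ← hb]; exact h2g)
  obtain ⟨hj3, hj4⟩ := hj j hj1 hj2
  have hqx : f (q i₁) = f (p i₁) - f (p i₁ - q i₁) := by rw [map_sub]; abel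
  rw [map_sub f (p j)] at hj3 hj4
  rcases dec2 (f (p i₁)) _ _ _ h2g hg0 hj3 hj4 with h1 | h1 | h1 | h1
  · exact hs.once_p h i₁ j i₂ hne.symm h1.symm hpp
  · rw [← hqx] at h1
    refine hs.once_p hfl i₁ j i₂ hne.symm ?_ ?_
    · simp [hj1, hj2, h1]
    · simp [hqq]
  · refine hs.once_q hfl j i₁ i₂ hne.symm ?_ ?_
    · simp [hj1, hj2, h1]
    · simp [hpp]
  · rw [← hqx] at h1
    exact hs.once_q h j i₁ i₂ hne.symm h1 hqq

theorem Setup.no_zero_aux [NeZero m] (hs : Setup m ι R S f e) (h : Arr S p q) (i₀ : ι)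
    (h0 : f (p i₀ - q i₀) = 0) (i : ι) (hi : i ≠ i₀) :
    m = Fintype.card ι ∧ f (p i₀) - f (q i) = f (p i) - f (p i₀) ∧
      ∀ j, j ≠ i → j ≠ i₀ → f (p j - q j) = f (p i) - f (p i₀) := by
  have hsw := h.swap i₀ i
  have hother : ∀ j, j ≠ i → j ≠ i₀ → (q ∘ Equiv.swap i₀ i) j = q j := by
    intro j h1 h2; simp [Equiv.swap_apply_of_ne_of_ne h2 h1]
  have hq1 : (q ∘ Equiv.swap i₀ i) i₀ = q i := by simp
  have hq2 : (q ∘ Equiv.swap i₀ i) i = q i₀ := by simp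
  have hpq : f (q i₀) = f (p i₀) := by
    rw [map_sub, sub_eq_zero] at h0; exact h0.symm
  rcases hs.trichotomy hsw with ⟨hm, hconst, hmin⟩ | ⟨j, hj⟩ | ⟨hm, a, b, hab, h1, h2, h3, h4⟩
  · have e1 := hconst i₀ i
    rw [hq1, hq2, map_sub, map_sub, hpq] at e1
    refine ⟨hm, e1, fun j hj1 hj2 => ?_⟩
    have e2 := hconst j i
    rw [hother j hj1 hj2, hq2, map_sub f (p i), hpq] at e2
    exact e2
  · exfalso
    by_cases hj1 : j = i
    · subst hj1
      rw [hq2, map_sub, hpq, sub_eq_zero] at hj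
      exact hs.zero_once_p h i₀ j hi h0 hj
    · by_cases hj2 : j = i₀
      · subst hj2
        rw [hq1, map_sub, sub_eq_zero] at hj
        exact hs.zero_once_q h j i hi h0 hj.symm
      · rw [hother j hj1 hj2] at hj
        exact hs.two_zeros h j i₀ hj2 hj h0
  · exact (hs.no_B hsw hm a b hab h1 h2 h3 h4).elim

theorem Setup.no_zero [NeZero m] (hs : Setup m ι R S f e) (h : Arr S p q) (i₀ : ι)
    (h0 : f (p i₀ - q i₀) = 0) : False := by
  have hpq : f (q i₀) = f (p i₀) := by
    rw [map_sub, sub_eq_zero] at h0; exact h0.symm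
  have h3 := hs.h3
  have hc1 : 1 < (univ.erase i₀).card := by
    rw [card_erase_of_mem (mem_univ _), card_univ]; omega
  obtain ⟨i, hi, j, hj, hij⟩ := one_lt_card.1 hc1
  have hi0 := (mem_erase.1 hi).1
  have hj0 := (mem_erase.1 hj).1
  obtain ⟨hm, ei, ci⟩ := hs.no_zero_aux h i₀ h0 i hi0
  obtain ⟨-, ej, cj⟩ := hs.no_zero_aux h i₀ h0 j hj0
  have bj := ci j hij.symm hj0
  have bi := cj i hij hi0
  by_cases hl : ∃ l, l ≠ i₀ ∧ l ≠ i ∧ l ≠ j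
  · obtain ⟨l, hl0, hli, hlj⟩ := hl
    have bl := ci l hli hl0
    have bl' := cj l hlj hl0
    rw [map_sub] at bi bj bl bl'
    have hpi : f (p i) = f (p i₀) := by
      have e1 : f (p i) - f (p i₀) = f (p j) - f (p i₀) := bl.symm.trans bl'
      have e2 : f (p i) - f (q i) = f (p i) - f (p i₀) := bi.trans e1.symm
      have e3 : f (q i) = f (p i₀) := sub_right_injective e2
      rw [e3, sub_self] at ei
      exact (sub_eq_zero.1 ei.symm)
    exact hs.zero_once_p h i₀ i hi0 h0 hpi
  · push Not at hl
    have hsub : (univ : Finset ι) ⊆ {i₀, i, j} := by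
      intro x _
      by_cases h1 : x = i₀
      · simp [h1]
      · by_cases h2 : x = i
        · simp [h2]
        · simp [hl x h1 h2]
    have hc := (card_le_card hsub).trans card_le_three
    rw [card_univ] at hc
    have hm3 : m = 3 := by omega
    clear hm
    subst hm3
    have dec : ∀ c pi qi pj qj : ZMod 3, c - qi = pi - c → c - qj = pj - c →
        pi - qi = pj - c → pj - qj = pi - c → pi = qj ∧ pj = qi := by
      intro c pi qi pj qj E1 E2 E3 _
      have h3 : (3 : ZMod 3) = 0 := by decide
      constructor
      · linear_combination E2 - E3 + E1 + (pi - c) * h3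
      · linear_combination -E3 + 2 * E1 + (pi - c) * h3
    rw [map_sub] at bi bj
    obtain ⟨e1, e2⟩ := dec _ _ _ _ _ ei ej bi bj
    refine hs.two_zeros (h.swap i j) i j hij ?_ ?_
    · simp [e1]
    · simp [e2]

theorem Setup.const_all [NeZero m] (hs : Setup m ι R S f e) (h : Arr S p q) :
    m = Fintype.card ι ∧ (∀ i j, f (p i - q i) = f (p j - q j)) ∧
      ∀ A : Finset ι, ∑ i ∈ A, f (p i - q i) = 0 → A = ∅ ∨ A = univ := by
  rcases hs.trichotomy h with h1 | ⟨i, hi⟩ | ⟨hm, a, b, hab, h1, h2, h3, h4⟩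
  · exact h1
  · exact (hs.no_zero h i hi).elim
  · exact (hs.no_B h hm a b hab h1 h2 h3 h4).elim

theorem Setup.final [NeZero m] (hs : Setup m ι R S f e) (h : Arr S p q) :
    ∀ i j, f (q i) = f (q j) ∧ f (p i) = f (p j) := by
  have key : ∀ i j, f (q i) = f (q j) := by
    intro i j
    by_cases hij : i = j
    · rw [hij]
    obtain ⟨l, hl1, hl2⟩ : ∃ j', j' ≠ i ∧ j' ≠ j := by
      by_contra hcon
      push Not at hcon
      have hsub : (univ : Finset ι) ⊆ {i, j} := by
        intro x _
        by_cases hx : x = i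
        · simp [hx]
        · simp [hcon x hx]
      have := card_le_card hsub
      rw [card_pair hij, card_univ] at this
      have := hs.h3
      omega
    have e1 := (hs.const_all h).2.1 i l
    have e2 := (hs.const_all (h.swap i j)).2.1 i l
    have e3 : (q ∘ Equiv.swap i j) l = q l := by simp [Equiv.swap_apply_of_ne_of_ne hl1 hl2]
    have e4 : (q ∘ Equiv.swap i j) i = q j := by simp
    rw [e3, e4, ← e1, map_sub, map_sub] at e2
    exact (sub_right_injective e2).symm
  intro i j
  refine ⟨key i j, ?_⟩
  have e1 := (hs.const_all h).2.1 i j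
  rw [map_sub, map_sub, key i j] at e1
  exact sub_left_injective e1

end arr

/-! ### The cyclic group `ZMod (2 * m)` -/

theorem sum_two_values {ι R M : Type*} [Fintype ι] [AddCommGroup R] [AddCommMonoid M]
    (p : ι → R) (x e : R) (hp : ∀ i, p i = x ∨ p i = e + x) :
    ∃ v, v ≤ Fintype.card ι ∧ (∀ F : R → M, ∑ i, F (p i) =
      v • F x + (Fintype.card ι - v) • F (e + x)) ∧
      ∑ i, p i = v • x + (Fintype.card ι - v) • (e + x) := by
  classical
  have key : ∀ {N : Type _} [AddCommMonoid N] (F : R → N), ∑ i, F (p i) =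
      (univ.filter (fun i => p i = x)).card • F x +
      (Fintype.card ι - (univ.filter (fun i => p i = x)).card) • F (e + x) := by
    intro N _ F
    rw [← sum_filter_add_sum_filter_not univ (fun i => p i = x)]
    have h1 := card_filter_add_card_filter_not (s := (univ : Finset ι)) (fun i => p i = x)
    rw [card_univ] at h1
    have h2 : Fintype.card ι - (univ.filter (fun i => p i = x)).card =
      (univ.filter (fun i => ¬ p i = x)).card := by omega
    rw [h2, ← sum_const, ← sum_const]
    congr 1
    · refine sum_congr rfl (fun i hi => ?_)
      rw [(mem_filter.1 hi).2]
    · refine sum_congr rfl (fun i hi => ?_)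
      rcases hp i with h | h
      · exact absurd h (mem_filter.1 hi).2
      · rw [h]
  have key2 : ∑ i, p i =
      (univ.filter (fun i => p i = x)).card • x +
      (Fintype.card ι - (univ.filter (fun i => p i = x)).card) • (e + x) := by
    rw [← sum_filter_add_sum_filter_not univ (fun i => p i = x)]
    have h1 := card_filter_add_card_filter_not (s := (univ : Finset ι)) (fun i => p i = x)
    rw [card_univ] at h1
    have h2 : Fintype.card ι - (univ.filter (fun i => p i = x)).card =
      (univ.filter (fun i => ¬ p i = x)).card := by omega
    rw [h2, ← sum_const, ← sum_const]
    congr 1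
    · refine sum_congr rfl (fun i hi => ?_)
      rw [(mem_filter.1 hi).2]
    · refine sum_congr rfl (fun i hi => ?_)
      rcases hp i with h | h
      · exact absurd h (mem_filter.1 hi).2
      · rw [h]
  exact ⟨_, (card_le_univ _), key, key2⟩

theorem setup_zmod (m k : ℕ) (hm : 2 ≤ m) (hk : m ≤ k) (h3 : 3 ≤ k)
    (T : Multiset (ZMod (2 * m)))
    (hmin : ∀ p q : Fin k → ZMod (2 * m), Arr T p q → ∀ A : Finset (Fin k),
      ∑ i ∈ A, (p i - q i) = 0 → A = ∅ ∨ A = univ) :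
    Setup m (Fin k) (ZMod (2 * m)) T
      ((ZMod.castHom (dvd_mul_left m 2) (ZMod m)).toAddMonoidHom) (m : ZMod (2 * m)) where
  ker := by
    intro x hx
    obtain ⟨a, rfl⟩ := ZMod.intCast_surjective x
    have hx' : ((a : ℤ) : ZMod m) = 0 := by simpa using hx
    rw [ZMod.intCast_zmod_eq_zero_iff_dvd _ m] at hx'
    obtain ⟨c, rfl⟩ := hx'
    rcases Int.even_or_odd' c with ⟨d, rfl | rfl⟩
    · left
      rw [ZMod.intCast_zmod_eq_zero_iff_dvd _ (2 * m)]
      exact ⟨d, by push_cast; ring⟩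
    · right
      have : (((m : ℤ) : ℤ) : ZMod (2 * m)) = (m : ZMod (2 * m)) := by simp
      rw [← this, ZMod.intCast_eq_intCast_iff_dvd_sub]
      exact ⟨-d, by push_cast; ring⟩
  fe := by simp
  ee := by
    have : ((2 * m : ℕ) : ZMod (2 * m)) = 0 := ZMod.natCast_self _
    push_cast at this
    rw [← two_mul]; exact this
  hm := hm
  hk := by simpa using hk
  h3 := by simpa using h3
  hmin := hmin

theorem zmod_large (m k : ℕ) (hm : 2 ≤ m) (hk : m ≤ k) (h3 : 3 ≤ k)
    (T : Multiset (ZMod (2 * m)))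
    (hmin : ∀ p q : Fin k → ZMod (2 * m), Arr T p q → ∀ A : Finset (Fin k),
      ∑ i ∈ A, (p i - q i) = 0 → A = ∅ ∨ A = univ)
    (p q : Fin k → ZMod (2 * m)) (h : Arr T p q) :
    k = m ∧ ∃ x y : ℤ, ∃ v w : ℕ,
      x ∈ Set.Icc (0 : ℤ) (((2 * m : ℕ) : ℤ) - 1) ∧ y ∈ Set.Icc (0 : ℤ) (((2 * m : ℕ) : ℤ) - 1) ∧
      ¬ (2 * x ≡ 2 * y [ZMOD ((2 * m : ℕ) : ℤ)]) ∧
      Int.gcd (x - y) (m : ℤ) = 1 ∧ v ≤ m ∧ w ≤ m ∧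
      (x - y ≡ (v : ℤ) - (w : ℤ) [ZMOD 2]) ∧
      T = Multiset.replicate v (x : ZMod (2 * m)) +
          Multiset.replicate (m - v) (((m : ℤ) + x : ℤ) : ZMod (2 * m)) +
          Multiset.replicate w (y : ZMod (2 * m)) +
          Multiset.replicate (m - w) (((m : ℤ) + y : ℤ) : ZMod (2 * m)) := by
  have : NeZero m := ⟨by omega⟩
  have : NeZero (2 * m) := ⟨by omega⟩
  have hs := setup_zmod m k hm hk h3 T hmin
  obtain ⟨hmk, hconst, hminb⟩ := hs.const_all h
  have hfin := hs.final h
  rw [Fintype.card_fin] at hmk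
  subst hmk
  refine ⟨rfl, ?_⟩
  set f := (ZMod.castHom (dvd_mul_left m 2) (ZMod m)).toAddMonoidHom with hf
  let i₀ : Fin m := ⟨0, by omega⟩
  have hval : ∀ a : ZMod (2 * m), ((a.val : ℤ) : ZMod (2 * m)) = a := by
    intro a; simp
  have hrange : ∀ a : ZMod (2 * m), (a.val : ℤ) ∈ Set.Icc (0 : ℤ) (((2 * m : ℕ) : ℤ) - 1) := by
    intro a
    have := ZMod.val_lt a
    constructor <;> omega
  have hsplit : ∀ (r : Fin m → ZMod (2 * m)), (∀ i, f (r i) = f (r i₀)) →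
      ∀ i, r i = r i₀ ∨ r i = (m : ZMod (2 * m)) + r i₀ := by
    intro r hr i
    rcases hs.ker (r i - r i₀) (by rw [map_sub, hr i, sub_self]) with h1 | h1
    · left; exact sub_eq_zero.1 h1
    · right; exact sub_eq_iff_eq_add.1 h1
  obtain ⟨v, hv, hvm, hvs⟩ := sum_two_values (M := Multiset (ZMod (2 * m))) p (p i₀) m
    (hsplit p (fun i => (hfin i i₀).2))
  obtain ⟨w, hw, hwm, hws⟩ := sum_two_values (M := Multiset (ZMod (2 * m))) q (q i₀) m
    (hsplit q (fun i => (hfin i i₀).1))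
  rw [Fintype.card_fin] at hv hw hvm hwm hvs hws
  obtain ⟨x, hx⟩ : ∃ x : ℤ, x = ((p i₀).val : ℤ) := ⟨_, rfl⟩
  obtain ⟨y, hy⟩ : ∃ y : ℤ, y = ((q i₀).val : ℤ) := ⟨_, rfl⟩
  have hxp : (x : ZMod (2 * m)) = p i₀ := by rw [hx, hval]
  have hyq : (y : ZMod (2 * m)) = q i₀ := by rw [hy, hval]
  have hb : f (p i₀ - q i₀) = ((x - y : ℤ) : ZMod m) := by
    rw [← hxp, ← hyq, ← Int.cast_sub]
    simp [hf]
  have hgcd : Int.gcd (x - y) (m : ℤ) = 1 := by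
    obtain ⟨t, ht⟩ : ∃ t : ℕ, t = Int.gcd (x - y) (m : ℤ) := ⟨_, rfl⟩
    have h1 : (t : ℤ) ∣ x - y := ht ▸ Int.gcd_dvd_left (x - y) (m : ℤ)
    have h2 : (t : ℤ) ∣ (m : ℤ) := ht ▸ Int.gcd_dvd_right (x - y) (m : ℤ)
    rw [← ht]
    obtain ⟨s, hms⟩ := Int.natCast_dvd_natCast.1 h2
    have hsm : s ≤ (univ : Finset (Fin m)).card := by
      rw [card_univ, Fintype.card_fin]
      exact Nat.le_of_dvd (by omega) ⟨t, by rw [hms, mul_comm]⟩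
    obtain ⟨A, -, hA⟩ := exists_subset_card_eq hsm
    have hz : ∑ i ∈ A, f (p i - q i) = 0 := by
      rw [sum_congr rfl (fun i _ => hconst i i₀), sum_const, hA, hb, nsmul_eq_mul]
      have : ((s : ℕ) : ZMod m) * ((x - y : ℤ) : ZMod m) = (((s : ℤ) * (x - y) : ℤ) : ZMod m) := by
        push_cast; ring
      rw [this, ZMod.intCast_zmod_eq_zero_iff_dvd _ m]
      obtain ⟨c, hc⟩ := h1
      refine ⟨c, ?_⟩
      rw [hc]
      have : (m : ℤ) = t * s := by exact_mod_cast hms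
      rw [this]; ring
    rcases hminb A hz with h3 | h3
    · rw [h3, card_empty] at hA
      rw [← hA] at hms
      omega
    · rw [h3, card_univ, Fintype.card_fin] at hA
      rw [← hA] at hms
      have : 0 < m := by omega
      nlinarith [Nat.eq_of_mul_eq_mul_right this (show t * m = 1 * m by omega)]
  refine ⟨x, y, v, w, hx ▸ hrange _, hy ▸ hrange _, ?_, hgcd, hv, hw, ?_, ?_⟩
  · intro hcon
    have h1 : ((2 * m : ℕ) : ℤ) ∣ 2 * y - 2 * x := hcon.dvd
    have h2 : (m : ℤ) ∣ x - y := by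
      obtain ⟨c, hc⟩ := h1
      refine ⟨-c, ?_⟩
      push_cast at hc
      linarith
    have h3 := Int.gcd_eq_right_iff_dvd (by omega : (0 : ℤ) ≤ (m : ℤ)) |>.2 h2
    rw [hgcd] at h3
    omega
  · have h2 := h.2
    rw [sum_sub_distrib, hvs, hws, ← hxp, ← hyq] at h2
    have h4 : (((v : ℤ) * x + ((m : ℤ) - v) * (m + x) - (w * y + ((m : ℤ) - w) * (m + y)) : ℤ) :
        ZMod (2 * m)) = 0 := by
      rw [← h2]
      simp only [nsmul_eq_mul, Nat.cast_sub hv, Nat.cast_sub hw]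
      push_cast; ring
    rw [ZMod.intCast_zmod_eq_zero_iff_dvd _ (2 * m)] at h4
    obtain ⟨c, hc⟩ := h4
    push_cast at hc
    have hm0 : (m : ℤ) ≠ 0 := by omega
    have h5 : (m : ℤ) * (x - y - v + w) = m * (2 * c) := by linear_combination hc
    have h6 := mul_left_cancel₀ hm0 h5
    apply Int.ModEq.symm
    rw [Int.modEq_iff_dvd]
    exact ⟨c, by linarith⟩
  · rw [← h.1, sum_add_distrib, hvm (fun a => {a}), hwm (fun a => {a}), hxp, hyq]
    simp only [Multiset.nsmul_singleton, Int.cast_add, Int.cast_natCast, hxp, hyq]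
    rw [add_assoc (_ + _)]

theorem zmod_four_dec : ∀ a b c d : ZMod 4, a - c + (b - d) = 0 → a ≠ c → a ≠ d → b ≠ c → b ≠ d →
    ¬ (a = b ∧ c = d) → (({a} + {c} + ({b} + {d}) : Multiset (ZMod 4)) = {0, 1, 2, 3} ∨
      ∃ x y : ZMod 4, (x.val : ℤ) ≡ (y.val : ℤ) + 1 [ZMOD 2] ∧
        ({a} + {c} + ({b} + {d}) : Multiset (ZMod 4)) = Multiset.replicate 2 x + {y, y + 2}) := by
  set_option maxRecDepth 100000 in
  decide

theorem zmod_four (T : Multiset (ZMod 4))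
    (hmin : ∀ p q : Fin 2 → ZMod 4, Arr T p q → ∀ A : Finset (Fin 2),
      ∑ i ∈ A, (p i - q i) = 0 → A = ∅ ∨ A = univ)
    (p q : Fin 2 → ZMod 4) (h : Arr T p q) :
    T = {0, 1, 2, 3} ∨ ∃ x y : ℤ, x ∈ Set.Icc (0 : ℤ) 3 ∧ y ∈ Set.Icc (0 : ℤ) 3 ∧
      x ≡ y + 1 [ZMOD 2] ∧ T = Multiset.replicate 2 (x : ZMod 4) +
        {(y : ZMod 4), ((y + 2 : ℤ) : ZMod 4)} := by
  have hne : ∀ i j, p i ≠ q j := by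
    intro i j h0
    rcases hmin _ _ (h.swap i j) {i} (by simp [h0]) with h1 | h1
    · simp at h1
    · have := congrArg Finset.card h1
      simp at this
  have hT := h.1
  have h2 := h.2
  rw [Fin.sum_univ_two] at hT h2
  have hne2 : ¬ (p 0 = p 1 ∧ q 0 = q 1) := by
    rintro ⟨e1, e2⟩
    have harr : Arr T ![p 0, q 0] ![p 1, q 1] := by
      refine ⟨?_, ?_⟩
      · rw [← hT, Fin.sum_univ_two]
        simp only [Matrix.cons_val_zero, Matrix.cons_val_one]
        abel
      · simp [e1, e2]
    rcases hmin _ _ harr {0} (by simp [e1]) with h1 | h1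
    · simp at h1
    · have := congrArg Finset.card h1
      simp at this
  rcases zmod_four_dec (p 0) (p 1) (q 0) (q 1) h2 (hne _ _) (hne _ _) (hne _ _) (hne _ _)
    hne2 with h3 | ⟨x, y, h3, h4⟩
  · left; rw [← hT]; exact h3
  · right
    have hx := ZMod.val_lt x
    have hy := ZMod.val_lt y
    refine ⟨x.val, y.val, ⟨by omega, by omega⟩, ⟨by omega, by omega⟩, h3, ?_⟩
    rw [← hT, h4]
    simp

/-! ### Transfer to the dihedral group -/

/-- Products of reflections, two at a time. -/
theorem pairs_of_list {n : ℕ} {G : Type*} [Group G] (ψ φ : ZMod n → G)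
    (h0 : ψ 0 = 1) (hadd : ∀ a b, ψ (a + b) = ψ a * ψ b)
    (h2 : ∀ a b, φ a * φ b = ψ (a - b)) (h1 : ∀ a b, ψ a * φ b = φ (a + b)) :
    ∀ l : List (ZMod n), (∃ ps : List (ZMod n × ZMod n),
      (ps.map (fun x => ({x.1} : Multiset (ZMod n)) + {x.2})).sum = (l : Multiset (ZMod n)) ∧
      (l.map φ).prod = ψ ((ps.map (fun x => x.1 - x.2)).sum)) ∨
      ∃ a, (l.map φ).prod = φ a
  | [] => Or.inl ⟨[], by simp, by simp [h0]⟩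
  | [a] => Or.inr ⟨a, by simp⟩
  | a :: b :: l => by
    rcases pairs_of_list ψ φ h0 hadd h2 h1 l with ⟨ps, hps, hprod⟩ | ⟨c, hc⟩
    · left
      refine ⟨(a, b) :: ps, ?_, ?_⟩
      · rw [List.map_cons, List.sum_cons, hps]
        rfl
      · simp only [List.map_cons, List.prod_cons, List.sum_cons]
        rw [hprod, hadd, ← mul_assoc, h2]
    · right
      refine ⟨a - b + c, ?_⟩
      simp only [List.map_cons, List.prod_cons]
      rw [hc, ← mul_assoc, h2, h1]

theorem list_of_arr {n : ℕ} {G ι : Type*} [Group G] (ψ φ : ZMod n → G)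
    (h0 : ψ 0 = 1) (hadd : ∀ a b, ψ (a + b) = ψ a * ψ b)
    (h2 : ∀ a b, φ a * φ b = ψ (a - b)) (p q : ι → ZMod n) (A : Finset ι) :
    ∃ l : List G, (l : Multiset G) = ∑ i ∈ A, (({φ (p i)} : Multiset G) + {φ (q i)}) ∧
      l.prod = ψ (∑ i ∈ A, (p i - q i)) := by
  classical
  induction A using Finset.induction_on with
  | empty => exact ⟨[], by simp, by simp [h0]⟩
  | insert a A ha ih =>
    obtain ⟨l, hl, hprod⟩ := ih
    refine ⟨φ (p a) :: φ (q a) :: l, ?_, ?_⟩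
    · rw [sum_insert ha, ← hl]
      rfl
    · rw [sum_insert ha, List.prod_cons, List.prod_cons, hprod, hadd, ← mul_assoc, h2]

theorem arr_of_minimal {n : ℕ} {G : Type*} [Group G] (ψ φ : ZMod n → G)
    (h0 : ψ 0 = 1) (hinj : ∀ a, ψ a = 1 → a = 0) (hadd : ∀ a b, ψ (a + b) = ψ a * ψ b)
    (h2 : ∀ a b, φ a * φ b = ψ (a - b)) (h1 : ∀ a b, ψ a * φ b = φ (a + b))
    (hφ : ∀ a, φ a ≠ 1)
    (S : Multiset G) (hS : IsMinimalProductOne S) (hsupp : ∀ g ∈ S, ∃ a, g = φ a) :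
    ∃ (T : Multiset (ZMod n)) (k : ℕ) (p q : Fin k → ZMod n), S = T.map φ ∧
      Multiset.card S = 2 * k ∧ Arr T p q ∧
      ∀ p q : Fin k → ZMod n, Arr T p q → ∀ A : Finset (Fin k),
        ∑ i ∈ A, (p i - q i) = 0 → A = ∅ ∨ A = univ := by
  obtain ⟨hS0, ⟨l, hl, hlp⟩, hmin⟩ := hS
  choose! r hr using hsupp
  have hlr : (l.map r).map φ = l := by
    rw [List.map_map]
    nth_rewrite 2 [← List.map_id l]
    apply List.map_congr_left
    intro g hg
    exact (hr g (by rw [← hl]; exact hg)).symm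
  rcases pairs_of_list ψ φ h0 hadd h2 h1 (l.map r) with ⟨ps, hps, hprod⟩ | ⟨a, ha⟩
  swap
  · rw [hlr, hlp] at ha
    exact absurd ha.symm (hφ a)
  rw [hlr, hlp] at hprod
  have hST : S = Multiset.map φ ((l.map r : List (ZMod n)) : Multiset (ZMod n)) := by
    rw [Multiset.map_coe, hlr, hl]
  have harr : Arr ((l.map r : List (ZMod n)) : Multiset (ZMod n))
      (fun i : Fin ps.length => ps[i.1].1) (fun i : Fin ps.length => ps[i.1].2) := by
    refine ⟨?_, ?_⟩
    · rw [← hps]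
      exact Fin.sum_univ_fun_getElem ps (fun x => ({x.1} : Multiset (ZMod n)) + {x.2})
    · rw [← hinj _ hprod.symm]
      exact Fin.sum_univ_fun_getElem ps (fun x => x.1 - x.2)
  refine ⟨_, ps.length, _, _, hST, ?_, harr, ?_⟩
  · rw [hST, Multiset.card_map, ← harr.1, Multiset.card_sum]
    simp [mul_comm]
  · intro p q hpq A hA
    by_contra hcon
    push Not at hcon
    obtain ⟨hA0, hA1⟩ := hcon
    have hAc : ∑ i ∈ Aᶜ, (p i - q i) = 0 := by
      have e1 := sum_add_sum_compl A (fun i => p i - q i)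
      rw [hA, hpq.2, zero_add] at e1
      exact e1
    have hP : ∀ B : Finset (Fin ps.length), ∑ i ∈ B, (p i - q i) = 0 →
        IsProductOne (∑ i ∈ B, (({φ (p i)} : Multiset G) + {φ (q i)})) := by
      intro B hB
      obtain ⟨l', hl', hp'⟩ := list_of_arr ψ φ h0 hadd h2 p q B
      exact ⟨l', hl', by rw [hp', hB, h0]⟩
    have hN : ∀ B : Finset (Fin ps.length), B.Nonempty →
        (∑ i ∈ B, (({φ (p i)} : Multiset G) + {φ (q i)})) ≠ 0 := by
      intro B hB h3
      have := congrArg Multiset.card h3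
      rw [Multiset.card_sum] at this
      simp at this
      exact hB.ne_empty this
    have hA0' : A.Nonempty := by
      exact hA0
    have hA1' : Aᶜ.Nonempty := by
      rw [nonempty_iff_ne_empty]
      intro h3
      exact hA1 (by simpa using h3)
    refine hmin _ _ (hN A hA0') (hN Aᶜ hA1') (hP A hA) (hP Aᶜ hAc) ?_
    rw [sum_add_sum_compl, hST, ← hpq.1]
    have : ∀ T : Multiset (ZMod n), T.map φ = Multiset.mapAddMonoidHom φ T := fun _ => rfl
    rw [this, map_sum]
    simp

theorem dihedral_facts (n : ℕ) (hn : 4 ≤ n)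
    (G : Type*) [Group G] (α τ : G) (hcardG : Nat.card G = 2 * n)
    (hgen : Subgroup.closure {α, τ} = ⊤) (hα : α ^ n = 1) (hτ : τ ^ 2 = 1)
    (hrel : τ * α = α⁻¹ * τ) :
    orderOf α = n ∧ (∀ a : ℤ, τ * α ^ a = α ^ (-a) * τ) ∧ τ ∉ Subgroup.zpowers α ∧
      ∀ g : G, g ∈ Subgroup.zpowers α ∨ ∃ a : ℤ, g = α ^ a * τ := by
  have hsc : ∀ a : ℤ, τ * α ^ a = α ^ (-a) * τ := by
    intro a
    have h1 : SemiconjBy τ α α⁻¹ := hrel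
    have h2 := h1.zpow_right a
    rw [inv_zpow, ← zpow_neg] at h2
    exact h2
  have hττ : τ * τ = 1 := by rw [← sq]; exact hτ
  have hτi : τ⁻¹ = τ := inv_eq_of_mul_eq_one_left hττ
  have hall : ∀ g : G, (∃ a : ℤ, g = α ^ a) ∨ ∃ a : ℤ, g = α ^ a * τ := by
    intro g
    have hg : g ∈ Subgroup.closure {α, τ} := by rw [hgen]; trivial
    induction hg using Subgroup.closure_induction with
    | mem x hx =>
      rcases hx with rfl | hx
      · left; exact ⟨1, by simp⟩
      · right; rw [Set.mem_singleton_iff] at hx; exact ⟨0, by simp [hx]⟩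
    | one => left; exact ⟨0, by simp⟩
    | mul x y _ _ hx hy =>
      rcases hx with ⟨a, rfl⟩ | ⟨a, rfl⟩ <;> rcases hy with ⟨b, rfl⟩ | ⟨b, rfl⟩
      · left; exact ⟨a + b, by rw [zpow_add]⟩
      · right; exact ⟨a + b, by rw [zpow_add, mul_assoc]⟩
      · right; exact ⟨a + -b, by rw [zpow_add, mul_assoc, hsc, mul_assoc]⟩
      · left
        refine ⟨a + -b, ?_⟩
        rw [mul_assoc, ← mul_assoc τ, hsc, mul_assoc (α ^ (-b)), hττ, mul_one, zpow_add]
    | inv x _ hx =>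
      rcases hx with ⟨a, rfl⟩ | ⟨a, rfl⟩
      · left; exact ⟨-a, by rw [zpow_neg]⟩
      · right
        refine ⟨a, ?_⟩
        rw [mul_inv_rev, hτi, ← zpow_neg, hsc, neg_neg]
  have hfin : Finite G := Nat.finite_of_card_ne_zero (by omega)
  have hdvd : orderOf α ∣ n := orderOf_dvd_of_pow_eq_one hα
  have hle : orderOf α ≤ n := Nat.le_of_dvd (by omega) hdvd
  have hge : Nat.card G ≤ 2 * orderOf α := by
    have hsurj : Function.Surjective (fun x : Subgroup.zpowers α × Bool =>
        if x.2 then (x.1 : G) else (x.1 : G) * τ) := by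
      intro g
      rcases hall g with ⟨a, rfl⟩ | ⟨a, rfl⟩
      · exact ⟨(⟨α ^ a, a, rfl⟩, true), by simp⟩
      · exact ⟨(⟨α ^ a, a, rfl⟩, false), by simp⟩
    have := Nat.card_le_card_of_surjective _ hsurj
    rw [Nat.card_prod, Nat.card_zpowers] at this
    simp at this
    omega
  refine ⟨by omega, hsc, ?_, ?_⟩
  · intro hmem
    obtain ⟨c, hc⟩ := hmem
    have hsurj : Function.Surjective (fun x : Subgroup.zpowers α => (x : G)) := by
      intro g
      rcases hall g with ⟨a, rfl⟩ | ⟨a, rfl⟩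
      · exact ⟨⟨α ^ a, a, rfl⟩, rfl⟩
      · refine ⟨⟨α ^ (a + c), a + c, rfl⟩, ?_⟩
        simp only at hc
        simp only [zpow_add, hc]
    have := Nat.card_le_card_of_surjective _ hsurj
    rw [Nat.card_zpowers] at this
    omega
  · intro g
    rcases hall g with ⟨a, ha⟩ | h
    · left; exact ⟨a, ha.symm⟩
    · right; exact h

theorem minimal_product_one_outside_cyclic_dihedral_even
    (n : ℕ) (hn : 4 ≤ n) (heven : Even n)
    (G : Type*) [Group G] (α τ : G) (hcardG : Nat.card G = 2 * n)
    (hgen : Subgroup.closure {α, τ} = ⊤) (hα : α ^ n = 1) (hτ : τ ^ 2 = 1)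
    (hrel : τ * α = α⁻¹ * τ)
    (S : Multiset G) (hS : IsMinimalProductOne S) (hlen : n ≤ Multiset.card S)
    (hsupp : ∀ g ∈ S, g ∉ Subgroup.zpowers α) :
    Multiset.card S = n ∧
      (n = 4 →
        (S = {τ, α * τ, α ^ 2 * τ, α ^ 3 * τ} ∨
          ∃ x y : ℤ, x ∈ Set.Icc (0 : ℤ) 3 ∧ y ∈ Set.Icc (0 : ℤ) 3 ∧
            x ≡ y + 1 [ZMOD 2] ∧
            S = Multiset.replicate 2 (α ^ x * τ) + {α ^ y * τ, α ^ (y + 2) * τ})) ∧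
      (6 ≤ n →
        ∃ x y : ℤ, ∃ v w : ℕ,
          x ∈ Set.Icc (0 : ℤ) ((n : ℤ) - 1) ∧ y ∈ Set.Icc (0 : ℤ) ((n : ℤ) - 1) ∧
          ¬ (2 * x ≡ 2 * y [ZMOD (n : ℤ)]) ∧
          Int.gcd (x - y) ((n / 2 : ℕ) : ℤ) = 1 ∧
          v ≤ n / 2 ∧ w ≤ n / 2 ∧
          (x - y ≡ (v : ℤ) - (w : ℤ) [ZMOD 2]) ∧
          S = Multiset.replicate v (α ^ x * τ) +
              Multiset.replicate (n / 2 - v) (α ^ (((n / 2 : ℕ) : ℤ) + x) * τ) +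
              Multiset.replicate w (α ^ y * τ) +
              Multiset.replicate (n / 2 - w) (α ^ (((n / 2 : ℕ) : ℤ) + y) * τ)) := by
  obtain ⟨hord, hsc, hτn, hall⟩ := dihedral_facts n hn G α τ hcardG hgen hα hτ hrel
  have hττ : τ * τ = 1 := by rw [← sq]; exact hτ
  obtain ⟨ψ, hψ⟩ : ∃ ψ : ZMod n → G, ∀ a : ℤ, ψ (a : ZMod n) = α ^ a := by
    refine ⟨fun a => α ^ (a.cast : ℤ), fun a => ?_⟩
    rw [zpow_eq_zpow_iff_modEq, hord, ← ZMod.intCast_eq_intCast_iff]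
    simp
  obtain ⟨φ, hφ⟩ : ∃ φ : ZMod n → G, ∀ a, φ a = ψ a * τ := ⟨_, fun _ => rfl⟩
  have hφz : ∀ a : ℤ, φ (a : ZMod n) = α ^ a * τ := fun a => by rw [hφ, hψ]
  have h0 : ψ 0 = 1 := by simpa using hψ 0
  have hadd : ∀ a b, ψ (a + b) = ψ a * ψ b := by
    intro a b
    obtain ⟨a, rfl⟩ := ZMod.intCast_surjective a
    obtain ⟨b, rfl⟩ := ZMod.intCast_surjective b
    rw [← Int.cast_add, hψ, hψ, hψ, zpow_add]
  have hinj : ∀ a, ψ a = 1 → a = 0 := by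
    intro a ha
    obtain ⟨a, rfl⟩ := ZMod.intCast_surjective a
    rw [hψ, ← orderOf_dvd_iff_zpow_eq_one, hord] at ha
    exact (ZMod.intCast_zmod_eq_zero_iff_dvd _ n).2 ha
  have h2 : ∀ a b, φ a * φ b = ψ (a - b) := by
    intro a b
    obtain ⟨a, rfl⟩ := ZMod.intCast_surjective a
    obtain ⟨b, rfl⟩ := ZMod.intCast_surjective b
    rw [← Int.cast_sub, hψ, hφz, hφz, mul_assoc, ← mul_assoc τ, hsc, mul_assoc (α ^ (-b)), hττ,
      mul_one, sub_eq_add_neg, zpow_add]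
  have h1 : ∀ a b, ψ a * φ b = φ (a + b) := by
    intro a b
    rw [hφ, hφ, hadd, mul_assoc]
  have hφ1 : ∀ a, φ a ≠ 1 := by
    intro a ha
    obtain ⟨a, rfl⟩ := ZMod.intCast_surjective a
    rw [hφz] at ha
    apply hτn
    refine ⟨-a, ?_⟩
    simp only [zpow_neg]
    exact inv_eq_of_mul_eq_one_right ha
  obtain ⟨T, k, p, q, hST, hcard, harr, hmin⟩ :=
    arr_of_minimal ψ φ h0 hinj hadd h2 h1 hφ1 S hS (by
      intro g hg
      rcases hall g with h | ⟨a, ha⟩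
      · exact absurd h (hsupp g hg)
      · exact ⟨(a : ZMod n), by rw [hφz, ha]⟩)
  obtain ⟨m, hm⟩ := heven
  have hnm : n = 2 * m := by omega
  clear hm
  subst hnm
  have hhalf : 2 * m / 2 = m := by omega
  by_cases hk3 : 3 ≤ k
  · obtain ⟨hkm, x, y, v, w, hx, hy, hxy, hg, hv, hw, hp, hT⟩ :=
      zmod_large m k (by omega) (by omega) hk3 T hmin p q harr
    refine ⟨by omega, fun h4 => by omega, fun _ => ⟨x, y, v, w, hx, hy, hxy, ?_⟩⟩
    rw [hhalf]
    refine ⟨hg, hv, hw, hp, ?_⟩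
    rw [hST, hT]
    simp only [Multiset.map_add, Multiset.map_replicate, hφz]
  · have hm2 : m = 2 := by omega
    have hk2 : k = 2 := by omega
    subst hm2
    subst hk2
    refine ⟨by omega, fun _ => ?_, fun h6 => by omega⟩
    rcases zmod_four T hmin p q harr with hT | ⟨x, y, hx, hy, hxy, hT⟩
    · left
      have e0 : φ 0 = τ := by simpa using hφz 0
      have e1 : φ 1 = α * τ := by simpa using hφz 1
      have e2 : φ 2 = α ^ 2 * τ := by simpa using hφz 2
      have e3 : φ 3 = α ^ 3 * τ := by simpa using hφz 3
      rw [hST, hT, ← e1, ← e2, ← e3]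
      nth_rewrite 1 [← e0]
      rfl
    · right
      refine ⟨x, y, hx, hy, hxy, ?_⟩
      rw [hST, hT, ← hφz, ← hφz, ← hφz, Multiset.map_add, Multiset.map_replicate]
      rfl
end
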